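/- For every η > 0 there exist n₀ ∈ ℕ and γ > 0 such that for every n > n₀ and every integer k > 0, every graph G on n vertices with average degree d̄(G) ≥ k + ηn contains every tree T on k vertices with maximum degree Δ(T) ≤ γk. -/

import Mathlib

open SimpleGraph Finset

/-- The degree of a vertex `v` in a graph `G` (number of neighbours). -/
noncomputable def degree' {V : Type*} (G : SimpleGraph V) (v : V) : ℕ :=
  (G.neighborSet v).ncard

/-- The average degree of a finite graph `G`, i.e. `2|E(G)|/|V(G)|`. -/
noncomputable def avgDeg {V : Type*} [Fintype V] (G : SimpleGraph V) : ℝ :=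
  (∑ v, (degree' G v : ℝ)) / (Fintype.card V)

/-- `G` contains `T` if there is an injective map of the vertices of `T` into those of
`G` mapping edges of `T` to edges of `G`. -/
def Contains {V W : Type*} (G : SimpleGraph V) (T : SimpleGraph W) : Prop :=
  ∃ φ : W → V, Function.Injective φ ∧ ∀ ⦃x y⦄, T.Adj x y → G.Adj (φ x) (φ y)

open Classical in
/-- The first vertex of `D` met when following the parent map `par` upwards from `y`
(or the vertex where the parent map stops decreasing). -/
noncomputable def pieceRoot (par : ℕ → ℕ) (D : Set ℕ) (y : ℕ) : ℕ :=
  if _h : par y < y ∧ y ∉ D then pieceRoot par D (par y) else y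
termination_by y
decreasing_by exact _h.1

theorem pieceRoot_of_mem {par : ℕ → ℕ} {D : Set ℕ} {y : ℕ} (h : y ∈ D) :
    pieceRoot par D y = y := by
  rw [pieceRoot, dif_neg (by tauto)]

theorem pieceRoot_of_notMem {par : ℕ → ℕ} {D : Set ℕ} {y : ℕ} (hp : par y < y) (h : y ∉ D) :
    pieceRoot par D y = pieceRoot par D (par y) := by
  rw [pieceRoot, dif_pos ⟨hp, h⟩]

theorem pieceRoot_le (par : ℕ → ℕ) (D : Set ℕ) (y : ℕ) : pieceRoot par D y ≤ y := by
  induction y using Nat.strong_induction_on with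
  | _ y ih =>
    rw [pieceRoot]
    split_ifs with h
    · exact (ih _ h.1).trans h.1.le
    · exact le_rfl

theorem pieceRoot_mem {par : ℕ → ℕ} {D : Set ℕ} {k : ℕ} (hpar : ∀ y < k, 0 < y → par y < y)
    (h0 : 0 ∈ D) {y : ℕ} (hy : y < k) : pieceRoot par D y ∈ D := by
  induction y using Nat.strong_induction_on with
  | _ y ih =>
    by_cases hD : y ∈ D
    · rwa [pieceRoot_of_mem hD]
    · have h : par y < y := hpar y hy (Nat.pos_of_ne_zero fun h => hD (h ▸ h0))
      rw [pieceRoot_of_notMem h hD]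
      exact ih _ h (h.trans hy)

theorem pieceRoot_insert_of_subset {par : ℕ → ℕ} {X D : Set ℕ} {d y : ℕ}
    (hXD : ∀ x ∈ X, d < x → x ∈ D) (hy : pieceRoot par (insert d D) y = d) :
    pieceRoot par (insert d X) y = d := by
  induction y using Nat.strong_induction_on with
  | _ y ih =>
    by_cases hyd : y = d
    · subst hyd; exact pieceRoot_of_mem (Set.mem_insert _ _)
    have hle := pieceRoot_le par (insert d D) y
    rw [hy] at hle
    by_cases hD : y ∈ insert d D
    · rw [pieceRoot_of_mem hD] at hy; exact absurd hy hyd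
    by_cases hp : par y < y
    · rw [pieceRoot_of_notMem hp hD] at hy
      have hX : y ∉ insert d X := by
        rintro (h | h)
        · exact hyd h
        · exact hD (Or.inr (hXD y h (by omega)))
      rw [pieceRoot_of_notMem hp hX]
      exact ih _ hp hy
    · rw [pieceRoot, dif_neg (by tauto)] at hy
      exact absurd hy hyd

open Classical in
/-- A rooted tree on `k` vertices has at most `k / L` vertices whose removal leaves only rooted
components with fewer than `L` vertices. -/
theorem exists_small_separator (par : ℕ → ℕ) (k L : ℕ) :
    ∃ X : Finset ℕ, (∀ x ∈ X, x < k) ∧ #X * L ≤ k ∧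
      ∀ d < k, d ∉ X → #{y ∈ range k | pieceRoot par (insert d (X : Set ℕ)) y = d} < L := by
  have key : ∀ i ≤ k, ∃ X : Finset ℕ, (∀ x ∈ X, k - i ≤ x ∧ x < k) ∧
      (∀ x ∈ X, L ≤ #{y ∈ range k | pieceRoot par (insert x (X : Set ℕ)) y = x}) ∧
      ∀ d < k, k - i ≤ d → d ∉ X →
        #{y ∈ range k | pieceRoot par (insert d (X : Set ℕ)) y = d} < L := by
    intro i
    induction i with
    | zero => intro _; exact ⟨∅, by simp, by simp, fun d hd hd' => by omega⟩
    | succ i ih =>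
      intro hi
      obtain ⟨X, h1, h2, h3⟩ := ih (by omega)
      set j := k - (i + 1) with hj
      by_cases hL : L ≤ #{y ∈ range k | pieceRoot par (insert j (X : Set ℕ)) y = j}
      · have hcongr : ∀ d, j ≤ d → ∀ y, pieceRoot par (insert d ((insert j X : Finset ℕ) : Set ℕ)) y = d
            ↔ pieceRoot par (insert d (X : Set ℕ)) y = d := by
          intro d hd y
          constructor
          · refine fun h => pieceRoot_insert_of_subset (fun x hx _ => ?_) h
            simp only [coe_insert, Set.mem_insert_iff, mem_coe] at hx ⊢; tauto
          · refine fun h => pieceRoot_insert_of_subset (fun x hx hdx => ?_) h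
            simp only [coe_insert, Set.mem_insert_iff, mem_coe] at hx ⊢
            rcases hx with hx | hx
            · omega
            · exact hx
        refine ⟨insert j X, ?_, ?_, ?_⟩
        · intro x hx
          rcases mem_insert.1 hx with rfl | hx
          · omega
          · have := h1 x hx; omega
        · intro x hx
          have hjx : j ≤ x := by
            rcases mem_insert.1 hx with rfl | hx
            · exact le_rfl
            · have := h1 x hx; omega
          simp only [hcongr x hjx]
          rcases mem_insert.1 hx with rfl | hx
          · exact hL
          · exact h2 x hx
        · intro d hd hjd hdX
          simp only [hcongr d hjd]
          rw [mem_insert, not_or] at hdX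
          exact h3 d hd (by omega) hdX.2
      · refine ⟨X, fun x hx => by have := h1 x hx; omega, h2, fun d hd hjd hdX => ?_⟩
        rcases hjd.eq_or_lt with h | h
        · rw [← h]; exact not_le.1 hL
        · exact h3 d hd (by omega) hdX
  obtain ⟨X, h1, h2, h3⟩ := key k le_rfl
  refine ⟨X, fun x hx => (h1 x hx).2, ?_, fun d hd hdX => h3 d hd (by omega) hdX⟩
  have : ∀ x ∈ X, L ≤ #{y ∈ range k | pieceRoot par (X : Set ℕ) y = x} := by
    intro x hx
    have := h2 x hx
    rwa [Set.insert_eq_of_mem (mem_coe.2 hx)] at this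
  calc #X * L ≤ ∑ x ∈ X, #{y ∈ range k | pieceRoot par (X : Set ℕ) y = x} := by
        rw [← smul_eq_mul]; exact card_nsmul_le_sum _ _ _ this
    _ ≤ #(range k) := by
        rw [← card_biUnion]
        · exact card_le_card fun y hy => by
            obtain ⟨x, _, hx⟩ := mem_biUnion.1 hy; exact (mem_filter.1 hx).1
        · intro x _ x' _ hxx'
          refine disjoint_left.2 fun y hy hy' => hxx' ?_
          rw [← (mem_filter.1 hy).2, ← (mem_filter.1 hy').2]
    _ = k := card_range k

open Classical in
/-- A properly 2-coloured rooted tree of maximum degree at most `Δ` splits into few small rooted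
pieces such that a piece whose root is not in the class `A` hangs from the root of another piece. -/
theorem exists_piece_roots (par : ℕ → ℕ) (A : ℕ → Prop) (k L Δ : ℕ) (hL : 0 < L) (hk : 0 < k)
    (hpar : ∀ y < k, 0 < y → par y < y)
    (hA : ∀ y < k, 0 < y → (A y ↔ ¬ A (par y)))
    (hΔ : ∀ x < k, #{y ∈ range k | 0 < y ∧ par y = x} ≤ Δ) :
    ∃ D : Finset ℕ, 0 ∈ D ∧ (#D - 1) * L ≤ k * (Δ + 2) ∧ (∀ d ∈ D, d < k) ∧
      (∀ d < k, #{y ∈ range k | pieceRoot par (D : Set ℕ) y = d} ≤ L) ∧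
      ∀ d ∈ D, 0 < d → ¬ A d → par d ∈ D := by
  obtain ⟨X, hXk, hXL, hX⟩ := exists_small_separator par k L
  set C : Finset ℕ := X.biUnion fun x => {y ∈ range k | 0 < y ∧ par y = x} with hC
  set Q : Finset ℕ := {x ∈ X | 0 < x ∧ ¬ A x}.image par with hQ
  set D : Finset ℕ := insert 0 (X ∪ C ∪ Q) with hD
  have hDk : ∀ d ∈ D, d < k := by
    intro d hd
    simp only [hD, hC, hQ, mem_insert, mem_union, mem_biUnion, mem_filter, mem_image,
      mem_range] at hd
    rcases hd with rfl | (hd | ⟨x, hx, hd, -⟩) | ⟨x, ⟨hx, hx0, hxA⟩, rfl⟩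
    · exact hk
    · exact hXk d hd
    · exact hd
    · exact (hpar x (hXk x hx) hx0).trans (hXk x hx)
  have hXD : X ⊆ D := fun x hx => by simp [hD, hx]
  have hCD : C ⊆ D := fun x hx => by simp [hD, hx]
  have hpD : ∀ x ∈ X, 0 < x → ¬ A x → par x ∈ D := fun x hx h0 hx' => by
    simp only [hD, mem_insert, mem_union]
    exact Or.inr (Or.inr (mem_image_of_mem _ (mem_filter.2 ⟨hx, h0, hx'⟩)))
  refine ⟨D, mem_insert_self _ _, ?_, hDk, ?_, ?_⟩
  · have h1 : #C ≤ #X * Δ := card_biUnion_le_card_mul _ _ _ fun x hx => hΔ x (hXk x hx)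
    have h2 : #Q ≤ #X := card_image_le.trans (card_filter_le _ _)
    have h3 : #D ≤ #X + #C + #Q + 1 :=
      (card_insert_le _ _).trans (Nat.add_le_add_right
        ((card_union_le _ _).trans (Nat.add_le_add_right (card_union_le _ _) _)) 1)
    calc (#D - 1) * L ≤ (#X * (Δ + 2)) * L := Nat.mul_le_mul_right _ (by
          have : #X * (Δ + 2) = #X + #X * Δ + #X := by ring
          omega)
      _ = (#X * L) * (Δ + 2) := by ring
      _ ≤ k * (Δ + 2) := Nat.mul_le_mul_right _ hXL
  · intro d hd
    by_cases hdX : d ∈ X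
    · have : #{y ∈ range k | pieceRoot par (D : Set ℕ) y = d} ≤ #({d} : Finset ℕ) := by
        refine card_le_card fun y hy => ?_
        rw [mem_filter, mem_range] at hy
        rw [mem_singleton]
        obtain ⟨hyk, hy⟩ := hy
        induction y using Nat.strong_induction_on with
        | _ y ih =>
          by_cases hyD : y ∈ D
          · rwa [pieceRoot_of_mem (mem_coe.2 hyD)] at hy
          · have hy0 : 0 < y := Nat.pos_of_ne_zero fun h => hyD (by simp [h, hD])
            have hp := hpar y hyk hy0
            rw [pieceRoot_of_notMem hp (by simpa using hyD)] at hy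
            have := ih _ hp (hp.trans hyk) hy
            refine absurd (hCD ?_) hyD
            simp only [hC, mem_biUnion, mem_filter, mem_range]
            exact ⟨d, hdX, hyk, hy0, this⟩
      exact this.trans (by rw [card_singleton]; exact hL)
    · by_cases hdD : d ∈ D
      · refine le_trans (card_le_card fun y hy => ?_) (hX d hd hdX).le
        rw [mem_filter] at hy ⊢
        refine ⟨hy.1, pieceRoot_insert_of_subset (D := D) (fun x hx _ => hXD hx) ?_⟩
        rw [Set.insert_eq_of_mem (mem_coe.2 hdD)]
        exact hy.2
      · rw [card_eq_zero.2]
        · exact Nat.zero_le _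
        · refine filter_eq_empty_iff.2 fun y hy h => hdD ?_
          rw [← h]
          exact pieceRoot_mem hpar (mem_coe.2 (mem_insert_self _ _)) (mem_range.1 hy)
  · intro d hd h0 hdA
    simp only [hD, hC, hQ, mem_insert, mem_union, mem_biUnion, mem_filter, mem_image,
      mem_range] at hd
    rcases hd with rfl | (hd | ⟨x, hx, hd, -, rfl⟩) | ⟨x, ⟨hx, hx0, hxA⟩, rfl⟩
    · omega
    · exact hpD d hd h0 hdA
    · exact hXD hx
    · exact absurd (not_not.1 fun h => hxA ((hA x (hXk x hx) hx0).2 h)) hdA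

/-- Dual form of the existence of a skew fractional matching. -/
theorem exists_light_pair {ι : Type*} [Fintype ι] [DecidableEq ι] (N : Finset ι)
    (B : ι → Finset ι) {P Q κ : ℝ} (hQ : 0 ≤ Q) (hQP : Q ≤ P) (hPQ : 0 < P + Q)
    (hN : P + Q ≤ κ * #N) (hB : ∀ a ∈ N, P + Q ≤ 2 * (κ * #(B a))) (hκ : 0 < κ)
    (w : ι → ℝ) (hw : ∀ c, 0 ≤ w c) :
    ∃ a ∈ N, ∃ b ∈ B a, P * w a + Q * w b ≤ κ * ∑ c, w c := by
  have hNne : N.Nonempty := by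
    rw [nonempty_iff_ne_empty]; rintro rfl; simp at hN; linarith
  obtain ⟨a, ha, hamin⟩ := exists_min_image N w hNne
  have hBne : (B a).Nonempty := by
    rw [nonempty_iff_ne_empty]; intro h
    have := hB a ha
    rw [h] at this; simp at this; linarith
  obtain ⟨b, hb, hbmin⟩ := exists_min_image (B a) w hBne
  refine ⟨a, ha, b, hb, ?_⟩
  have hBa := hB a ha
  rcases le_total (w b) (w a) with h | h
  · have h1 : (#N : ℝ) * w a ≤ ∑ c, w c :=
      calc (#N : ℝ) * w a = ∑ c ∈ N, w a := by simp
        _ ≤ ∑ c ∈ N, w c := sum_le_sum hamin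
        _ ≤ ∑ c, w c := sum_le_sum_of_subset_of_nonneg (subset_univ _) fun c _ _ => hw c
    calc P * w a + Q * w b ≤ (P + Q) * w a := by nlinarith
      _ ≤ κ * #N * w a := mul_le_mul_of_nonneg_right hN (hw a)
      _ = κ * (#N * w a) := by ring
      _ ≤ _ := mul_le_mul_of_nonneg_left h1 hκ.le
  · have h1 : (#N : ℝ) * w a + #(B a) * (w b - w a) ≤ ∑ c, w c :=
      calc (#N : ℝ) * w a + #(B a) * (w b - w a)
          = ∑ c, ((if c ∈ N then w a else 0) + if c ∈ B a then w b - w a else 0) := by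
            rw [sum_add_distrib, ← sum_filter, ← sum_filter]; simp; ring
        _ ≤ ∑ c, w c := by
            refine sum_le_sum fun c _ => ?_
            have := hw c
            have := hw a
            split_ifs with h1 h2 h2
            · have := hbmin c h2; linarith
            · have := hamin c h1; linarith
            · have := hbmin c h2; linarith
            · linarith
    have h2 := mul_le_mul_of_nonneg_left h1 hκ.le
    have h3 := mul_le_mul_of_nonneg_right hN (hw a)
    have h4 := mul_le_mul_of_nonneg_right hBa (sub_nonneg.2 h)
    nlinarith

/-- Existence of a skew fractional matching: a fractional family of pairs `(a, b)` with `a ∈ N`,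
`b ∈ B a`, in which the first and second members of a pair are loaded in proportion `P : Q`. -/
theorem exists_skew_matching {ι : Type*} [Fintype ι] [DecidableEq ι] (N : Finset ι)
    (B : ι → Finset ι) {P Q κ : ℝ} (hQ : 0 ≤ Q) (hQP : Q ≤ P) (hPQ : 0 < P + Q)
    (hN : P + Q ≤ κ * #N) (hB : ∀ a ∈ N, P + Q ≤ 2 * (κ * #(B a))) (hκ : 0 < κ) :
    ∃ y : ι → ι → ℝ, (∀ a b, 0 ≤ y a b) ∧ (∀ a b, 0 < y a b → a ∈ N ∧ b ∈ B a) ∧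
      ∑ a, ∑ b, y a b = 1 ∧ ∀ c, P * ∑ b, y c b + Q * ∑ a, y a c ≤ κ := by
  let load : (ι × ι → ℝ) →ₗ[ℝ] (ι → ℝ) :=
    { toFun := fun y c => P * ∑ b, y (c, b) + Q * ∑ a, y (a, c)
      map_add' := fun x y => by
        ext c; simp only [Pi.add_apply, sum_add_distrib]; ring
      map_smul' := fun r x => by
        ext c; simp only [Pi.smul_apply, smul_eq_mul, ← mul_sum, RingHom.id_apply]; ring }
  let S : Set (ι × ι → ℝ) := stdSimplex ℝ (ι × ι) ∩
    {y | ∀ p : ι × ι, ¬ (p.1 ∈ N ∧ p.2 ∈ B p.1) → y p = 0}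
  have hclosed : IsClosed {y : ι × ι → ℝ | ∀ p : ι × ι, ¬ (p.1 ∈ N ∧ p.2 ∈ B p.1) → y p = 0} := by
    simp only [Set.ofPred_forall]
    exact isClosed_iInter fun p => isClosed_iInter fun _ =>
      isClosed_eq (continuous_apply p) continuous_const
  have hconv : Convex ℝ {y : ι × ι → ℝ | ∀ p : ι × ι, ¬ (p.1 ∈ N ∧ p.2 ∈ B p.1) → y p = 0} := by
    intro x hx y hy s t _ _ _ p hp
    simp [hx p hp, hy p hp]
  have hScomp : IsCompact S := (isCompact_stdSimplex ℝ (ι × ι)).inter_right hclosed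
  have hSconv : Convex ℝ S := (convex_stdSimplex ℝ (ι × ι)).inter hconv
  have hload : Continuous load := load.continuous_of_finiteDimensional
  by_cases hdis : Disjoint (load '' S) (Set.Iic fun _ : ι => κ)
  · exfalso
    obtain ⟨f, u, v, h1, huv, h2⟩ := geometric_hahn_banach_compact_closed
      (hSconv.linear_image load) (hScomp.image hload) (convex_Iic _) isClosed_Iic hdis
    have hf : ∀ x : ι → ℝ, f x = ∑ c, x c * f (Pi.single c 1) := by
      intro x
      conv_lhs => rw [pi_eq_sum_univ' x]
      rw [map_sum]
      refine sum_congr rfl fun c _ => ?_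
      rw [map_smul, smul_eq_mul]
    set w : ι → ℝ := fun c => - f (Pi.single c 1) with hw
    have hκf : v < f (fun _ => κ) := h2 _ (Set.mem_Iic.2 le_rfl)
    have hw0 : ∀ c, 0 ≤ w c := by
      intro c
      by_contra hc
      push Not at hc
      have hc' : 0 < f (Pi.single c 1) := by simpa [hw] using hc
      obtain ⟨r, hr⟩ := exists_nat_gt ((f (fun _ => κ) - v) / f (Pi.single c 1))
      have hr0 : (0 : ℝ) ≤ r := Nat.cast_nonneg r
      have := h2 ((fun _ => κ) - (r : ℝ) • Pi.single c 1) (Set.mem_Iic.2 fun j => by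
        by_cases hj : j = c
        · subst hj; simp
        · simp [hj])
      rw [map_sub, map_smul, smul_eq_mul] at this
      rw [div_lt_iff₀ hc'] at hr
      linarith
    obtain ⟨a, ha, b, hb, hab⟩ := exists_light_pair N B hQ hQP hPQ hN hB hκ w hw0
    have hmem : Pi.single (a, b) 1 ∈ S := by
      refine ⟨single_mem_stdSimplex ℝ (a, b), fun p hp => ?_⟩
      rw [Pi.single_apply, if_neg]
      rintro rfl; exact hp ⟨ha, hb⟩
    have h3 := h1 _ (Set.mem_image_of_mem load hmem)
    rw [hf] at h3 hκf
    have e1 : ∑ c, load (Pi.single (a, b) 1) c * f (Pi.single c 1) = -(P * w a + Q * w b) := by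
      have : ∀ c, load (Pi.single (a, b) 1) c
          = P * (if c = a then 1 else 0) + Q * (if c = b then 1 else 0) := by
        intro c
        simp only [load, LinearMap.coe_mk, AddHom.coe_mk, Pi.single_apply, Prod.mk.injEq]
        congr 2
        · by_cases h : c = a <;> simp [h]
        · by_cases h : c = b <;> simp [h]
      simp only [this, add_mul, sum_add_distrib, mul_ite, mul_one, mul_zero, ite_mul, zero_mul,
        sum_ite_eq', mem_univ, if_true, hw]
      ring
    have e2 : ∑ c, κ * f (Pi.single c 1) = - (κ * ∑ c, w c) := by
      rw [← mul_sum]; simp [hw]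
    rw [e1] at h3
    rw [e2] at hκf
    linarith
  · rw [Set.not_disjoint_iff] at hdis
    obtain ⟨_, ⟨y, ⟨hy1, hy2⟩, rfl⟩, hy3⟩ := hdis
    refine ⟨fun a b => y (a, b), fun a b => hy1.1 _, fun a b hab => ?_, ?_, fun c => hy3 c⟩
    · by_contra h
      exact hab.ne' (hy2 (a, b) h)
    · rw [← hy1.2, Fintype.sum_prod_type]

open Classical in
/-- Online rounding of a fractional assignment `y` of pairs: there is an allowed pair for which the
quadratic potential measuring how far loads exceed their targets grows by a bounded amount. -/
theorem exists_balanced_pair {ι : Type*} [Fintype ι] (y : ι → ι → ℝ)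
    (hy0 : ∀ a b, 0 ≤ y a b) (hy1 : ∑ a, ∑ b, y a b = 1) (E : Finset ι) {δ : ℝ}
    (hδ : δ ≤ 1 / 2) (hE : ∑ a ∈ E, ∑ b, y a b ≤ δ) {p q : ℝ} (hp : 0 ≤ p) (hq : 0 ≤ q)
    (x : ι → ℝ) :
    ∃ a b, a ∉ E ∧ 0 < y a b ∧
      ∑ c, (max 0 (x c + ((if a = c then p else 0) + if b = c then q else 0)
        - (p * ∑ b, y c b + q * ∑ a, y a c) / (1 - δ))) ^ 2
        ≤ ∑ c, (max 0 (x c)) ^ 2 + 5 * (p + q) ^ 2 := by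
  set τ : ι → ℝ := fun c => (p * ∑ b, y c b + q * ∑ a, y a c) / (1 - δ) with hτ
  set inc : ι → ι → ι → ℝ := fun a b c => (if a = c then p else 0) + if b = c then q else 0
    with hinc
  have hδ1 : 0 < 1 - δ := by linarith
  set y' : ι → ι → ℝ := fun a b => if a ∈ E then 0 else y a b with hy'
  have hy'0 : ∀ a b, 0 ≤ y' a b := fun a b => by simp only [hy']; split_ifs; exacts [le_rfl, hy0 a b]
  have hy'le : ∀ a b, y' a b ≤ y a b := fun a b => by
    simp only [hy']; split_ifs; exacts [hy0 a b, le_rfl]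
  set t := ∑ a, ∑ b, y' a b with ht
  have htδ : 1 - δ ≤ t := by
    have h1 : ∑ a, ∑ b, y a b = t + ∑ a ∈ E, ∑ b, y a b := by
      rw [ht, ← sum_filter_add_sum_filter_not univ (· ∈ E) (fun a => ∑ b, y a b), add_comm]
      congr 1
      · rw [sum_filter]
        refine sum_congr rfl fun a _ => ?_
        by_cases h : a ∈ E <;> simp [hy', h]
      · simp
    linarith
  have hτ0 : ∀ c, 0 ≤ τ c := fun c => by
    refine div_nonneg (add_nonneg (mul_nonneg hp ?_) (mul_nonneg hq ?_)) hδ1.le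
    · exact sum_nonneg fun b _ => hy0 _ _
    · exact sum_nonneg fun b _ => hy0 _ _
  have hinc0 : ∀ a b c, 0 ≤ inc a b c := fun a b c => by
    simp only [hinc]; split_ifs <;> linarith
  have hτsum : ∑ c, τ c ≤ 2 * (p + q) := by
    have h2 : ∑ c, ∑ a, y a c = 1 := by rw [sum_comm]; exact hy1
    rw [hτ, ← sum_div, sum_add_distrib, ← mul_sum, ← mul_sum, hy1, h2, div_le_iff₀ hδ1]
    nlinarith
  have hincsum : ∀ a b, ∑ c, inc a b c = p + q := fun a b => by
    simp [hinc, sum_add_distrib]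
  have hsq : ∀ g : ι → ℝ, (∀ c, 0 ≤ g c) → ∑ c, g c ^ 2 ≤ (∑ c, g c) ^ 2 := fun g hg =>
    sum_sq_le_sq_sum_of_nonneg fun c _ => hg c
  -- pointwise bound on the new potential
  have hpt : ∀ a b, ∑ c, (max 0 (x c + inc a b c - τ c)) ^ 2
      ≤ ∑ c, (max 0 (x c)) ^ 2 + 2 * ∑ c, max 0 (x c) * (inc a b c - τ c) + 5 * (p + q) ^ 2 := by
    intro a b
    have h1 : ∀ c, (max 0 (x c + inc a b c - τ c)) ^ 2
        ≤ (max 0 (x c)) ^ 2 + 2 * (max 0 (x c) * (inc a b c - τ c))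
          + (inc a b c ^ 2 + τ c ^ 2) := by
      intro c
      have hi := hinc0 a b c
      have ht := hτ0 c
      have h2 : (max 0 (x c + inc a b c - τ c)) ^ 2 ≤ (max 0 (x c) + (inc a b c - τ c)) ^ 2 := by
        rcases le_total (x c + inc a b c - τ c) 0 with h | h
        · rw [max_eq_left h]; simp; positivity
        · rw [max_eq_right h]
          refine pow_le_pow_left₀ h ?_ 2
          have := le_max_right 0 (x c)
          linarith
      nlinarith [mul_nonneg hi ht]
    calc _ ≤ ∑ c, ((max 0 (x c)) ^ 2 + 2 * (max 0 (x c) * (inc a b c - τ c))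
          + (inc a b c ^ 2 + τ c ^ 2)) := sum_le_sum fun c _ => h1 c
      _ = ∑ c, (max 0 (x c)) ^ 2 + 2 * ∑ c, max 0 (x c) * (inc a b c - τ c)
          + (∑ c, inc a b c ^ 2 + ∑ c, τ c ^ 2) := by
          simp only [sum_add_distrib, mul_sum]
      _ ≤ _ := by
          have h3 := hsq _ (hinc0 a b)
          have h4 := hsq _ hτ0
          rw [hincsum] at h3
          have h5 : (∑ c, τ c) ^ 2 ≤ (2 * (p + q)) ^ 2 :=
            pow_le_pow_left₀ (sum_nonneg fun c _ => hτ0 c) hτsum 2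
          nlinarith
  have hdrift : ∑ a, ∑ b, y' a b * ∑ c, max 0 (x c) * (inc a b c - τ c) ≤ 0 := by
    have h1 : ∑ a, ∑ b, y' a b * ∑ c, max 0 (x c) * (inc a b c - τ c)
        = ∑ c, max 0 (x c) * (∑ a, ∑ b, y' a b * (inc a b c - τ c)) := by
      simp only [mul_sum]
      rw [sum_comm' (t' := univ) (s' := fun _ => univ) (by simp)]
      rw [sum_congr rfl fun b _ => sum_comm]
      rw [sum_comm]
      refine sum_congr rfl fun c _ => ?_
      rw [sum_comm]
      refine sum_congr rfl fun a _ => sum_congr rfl fun b _ => by ring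
    rw [h1]
    refine sum_nonpos fun c _ => mul_nonpos_of_nonneg_of_nonpos (le_max_left _ _) ?_
    have h2 : ∑ a, ∑ b, y' a b * (inc a b c - τ c)
        = p * ∑ b, y' c b + q * ∑ a, y' a c - t * τ c := by
      simp only [mul_sub, sum_sub_distrib, hinc, mul_add, sum_add_distrib, mul_ite, mul_zero,
        ht, sum_mul, mul_sum]
      congr 2
      · rw [sum_comm]; simp [mul_comm]
      · simp [mul_comm]
    rw [h2]
    have h3 : ∑ b, y' c b ≤ ∑ b, y c b := sum_le_sum fun b _ => hy'le _ _
    have h4 : ∑ a, y' a c ≤ ∑ a, y a c := sum_le_sum fun b _ => hy'le _ _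
    have h5 : (1 - δ) * τ c = p * ∑ b, y c b + q * ∑ a, y a c := by
      rw [hτ]; field_simp
    nlinarith [mul_le_mul_of_nonneg_left h3 hp, mul_le_mul_of_nonneg_left h4 hq,
      mul_le_mul_of_nonneg_right htδ (hτ0 c)]
  by_contra hcon
  push Not at hcon
  have hpos : ∀ a b, 0 < y' a b → 0 < ∑ c, max 0 (x c) * (inc a b c - τ c) := by
    intro a b hab
    have haE : a ∉ E := fun h => by simp [hy', h] at hab
    have := hcon a b haE (hab.trans_le (hy'le a b))
    have h2 := hpt a b
    linarith
  have hnn : ∀ a b, 0 ≤ y' a b * ∑ c, max 0 (x c) * (inc a b c - τ c) := by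
    intro a b
    rcases (hy'0 a b).eq_or_lt with h | h
    · rw [← h]; simp
    · exact mul_nonneg h.le (hpos a b h).le
  have ht0 : 0 < t := hδ1.trans_le htδ
  obtain ⟨a, _, ha⟩ := exists_lt_of_sum_lt (s := univ) (f := fun _ => (0 : ℝ))
    (g := fun a => ∑ b, y' a b) (by simpa [ht] using ht0)
  obtain ⟨b, _, hb⟩ := exists_lt_of_sum_lt (s := univ) (f := fun _ => (0 : ℝ))
    (g := fun b => y' a b) (by simpa using ha)
  have h6 : y' a b * ∑ c, max 0 (x c) * (inc a b c - τ c)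
      ≤ ∑ a, ∑ b, y' a b * ∑ c, max 0 (x c) * (inc a b c - τ c) :=
    (single_le_sum (f := fun b => y' a b * ∑ c, max 0 (x c) * (inc a b c - τ c))
      (fun b _ => hnn a b) (mem_univ b)).trans
      (single_le_sum (f := fun a => ∑ b, y' a b * ∑ c, max 0 (x c) * (inc a b c - τ c))
      (fun a _ => sum_nonneg fun b _ => hnn a b) (mem_univ a))
  have h7 := mul_pos hb (hpos a b hb)
  linarith

theorem exists_mem_notMem_of_card {V : Type*} [DecidableEq V] {C B U : Finset V} {g s t : ℝ}
    (hC : g ≤ #C) (hB : (#B : ℝ) ≤ s) (hU : (#U : ℝ) ≤ t) (h : s + t < g) :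
    ∃ z ∈ C, z ∉ B ∧ z ∉ U := by
  have h1 : #(B ∪ U) < #C := by
    have := card_union_le B U
    have h2 : ((#B + #U : ℕ) : ℝ) < #C := by push_cast; linarith
    have := Nat.cast_lt.1 h2
    omega
  obtain ⟨z, hz, hz'⟩ := exists_mem_notMem_of_card_lt_card h1
  exact ⟨z, hz, fun h => hz' (mem_union_left _ h), fun h => hz' (mem_union_right _ h)⟩

open Classical in
/-- Greedy embedding of a small piece of a rooted tree, alternating between the sets `FA` and `FB`,
once its root `d` has been placed at `z₀`. -/
theorem exists_piece_embedding {V : Type*} (G : SimpleGraph V) (par : ℕ → ℕ) (A : ℕ → Prop)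
    (D : Set ℕ) (k d L : ℕ) (h0 : 0 ∈ D)
    (hpar : ∀ y < k, 0 < y → par y < y)
    (hA : ∀ y < k, 0 < y → (A y ↔ ¬ A (par y)))
    (hL : #{y ∈ range k | pieceRoot par D y = d} ≤ L) (z₀ : V) (FA FB : Finset V)
    (GA GB : V → Prop) (hzA : A d → GA z₀) (hzB : ¬ A d → GB z₀)
    (hGA : ∀ x, GA x → ∀ U : Finset V, #U ≤ L → ∃ z ∈ FB, z ∉ U ∧ G.Adj x z ∧ GB z)
    (hGB : ∀ x, GB x → ∀ U : Finset V, #U ≤ L → ∃ z ∈ FA, z ∉ U ∧ G.Adj x z ∧ GA z) :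
    ∃ ψ : ℕ → V, ψ d = z₀ ∧ Set.InjOn ψ {x | x < k ∧ pieceRoot par D x = d} ∧
      (∀ x, x < k → pieceRoot par D x = d → (A x → GA (ψ x)) ∧ (¬ A x → GB (ψ x))) ∧
      ∀ x, x < k → pieceRoot par D x = d → x ≠ d →
        (A x → ψ x ∈ FA) ∧ (¬ A x → ψ x ∈ FB) ∧ G.Adj (ψ (par x)) (ψ x) := by
  have hpK : ∀ x < k, pieceRoot par D x = d → x ≠ d →
      0 < x ∧ par x < x ∧ pieceRoot par D (par x) = d := by
    intro x hx hxd hne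
    have hxD : x ∉ D := fun h => hne (by rw [← hxd, pieceRoot_of_mem h])
    have h0x : 0 < x := Nat.pos_of_ne_zero fun h => hxD (h ▸ h0)
    have hp := hpar x hx h0x
    exact ⟨h0x, hp, by rwa [pieceRoot_of_notMem hp hxD] at hxd⟩
  have key : ∀ i, ∃ ψ : ℕ → V, ψ d = z₀ ∧
      Set.InjOn ψ {x | x ≤ d + i ∧ x < k ∧ pieceRoot par D x = d} ∧
      (∀ x, x ≤ d + i → x < k → pieceRoot par D x = d →
        (A x → GA (ψ x)) ∧ (¬ A x → GB (ψ x))) ∧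
      ∀ x, x ≤ d + i → x < k → pieceRoot par D x = d → x ≠ d →
        (A x → ψ x ∈ FA) ∧ (¬ A x → ψ x ∈ FB) ∧ G.Adj (ψ (par x)) (ψ x) := by
    intro i
    induction i with
    | zero =>
      have hx : ∀ x, x ≤ d + 0 → pieceRoot par D x = d → x = d := fun x hx hxd => by
        have := pieceRoot_le par D x; omega
      refine ⟨fun _ => z₀, rfl, ?_, ?_, ?_⟩
      · rintro x ⟨h1, -, h2⟩ x' ⟨h1', -, h2'⟩ -
        rw [hx x h1 h2, hx x' h1' h2']
      · intro x h1 _ h2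
        rw [hx x h1 h2]; exact ⟨hzA, hzB⟩
      · intro x h1 _ h2 h3
        exact absurd (hx x h1 h2) h3
    | succ i ih =>
      obtain ⟨ψ, hψd, hinj, hgood, hemb⟩ := ih
      set j := d + (i + 1) with hj
      by_cases hjK : j < k ∧ pieceRoot par D j = d
      · obtain ⟨hjk, hjd⟩ := hjK
        obtain ⟨hj0, hpj, hpr⟩ := hpK j hjk hjd (by omega)
        have hple : par j ≤ d + i := by omega
        have hpg := hgood (par j) hple (hpj.trans hjk) hpr
        set U : Finset V := ({y ∈ range k | pieceRoot par D y = d}).image ψ with hU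
        have hUL : #U ≤ L := card_image_le.trans hL
        have hz : ∃ z, z ∉ U ∧ G.Adj (ψ (par j)) z ∧ (A j → z ∈ FA ∧ GA z) ∧
            (¬ A j → z ∈ FB ∧ GB z) := by
          by_cases hAj : A j
          · obtain ⟨z, h1, h2, h3, h4⟩ := hGB _ (hpg.2 ((hA j hjk hj0).1 hAj)) U hUL
            exact ⟨z, h2, h3, fun _ => ⟨h1, h4⟩, fun h => absurd hAj h⟩
          · obtain ⟨z, h1, h2, h3, h4⟩ := hGA _
              (hpg.1 (not_not.1 fun h => hAj ((hA j hjk hj0).2 h))) U hUL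
            exact ⟨z, h2, h3, fun h => absurd h hAj, fun _ => ⟨h1, h4⟩⟩
        obtain ⟨z, hzU, hzadj, hz1, hz2⟩ := hz
        have hup : ∀ x ≤ d + i, Function.update ψ j z x = ψ x := fun x hx =>
          Function.update_of_ne (by omega) _ _
        have hcase : ∀ x ≤ j, x = j ∨ x ≤ d + i := fun x hx => by omega
        refine ⟨Function.update ψ j z, by rw [hup d (by omega), hψd], ?_, ?_, ?_⟩
        · rintro x ⟨h1, h2, h3⟩ x' ⟨h1', h2', h3'⟩ hxx'
          rcases hcase x h1 with rfl | hx <;> rcases hcase x' h1' with rfl | hx'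
          · rfl
          · rw [Function.update_self, hup x' hx'] at hxx'
            exact absurd (hxx' ▸ mem_image_of_mem ψ (mem_filter.2 ⟨mem_range.2 h2', h3'⟩)) hzU
          · rw [Function.update_self, hup x hx] at hxx'
            exact absurd (hxx' ▸ mem_image_of_mem ψ (mem_filter.2 ⟨mem_range.2 h2, h3⟩)) hzU
          · rw [hup x hx, hup x' hx'] at hxx'
            exact hinj ⟨hx, h2, h3⟩ ⟨hx', h2', h3'⟩ hxx'
        · intro x h1 h2 h3
          rcases hcase x h1 with rfl | hx
          · rw [Function.update_self]; exact ⟨fun h => (hz1 h).2, fun h => (hz2 h).2⟩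
          · rw [hup x hx]; exact hgood x hx h2 h3
        · intro x h1 h2 h3 h4
          rcases hcase x h1 with rfl | hx
          · rw [Function.update_self, hup _ hple]
            exact ⟨fun h => (hz1 h).1, fun h => (hz2 h).1, hzadj⟩
          · have := (hpK x h2 h3 h4).2.1
            rw [hup x hx, hup (par x) (by omega)]
            exact hemb x hx h2 h3 h4
      · have hle : ∀ x, x ≤ j → x < k → pieceRoot par D x = d → x ≤ d + i := by
          intro x h1 h2 h3
          have : x ≠ j := fun h => hjK (h ▸ ⟨h2, h3⟩)
          omega
        exact ⟨ψ, hψd, fun x hx x' hx' => hinj ⟨hle x hx.1 hx.2.1 hx.2.2, hx.2⟩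
          ⟨hle x' hx'.1 hx'.2.1 hx'.2.2, hx'.2⟩,
          fun x h1 h2 h3 => hgood x (hle x h1 h2 h3) h2 h3,
          fun x h1 h2 h3 => hemb x (hle x h1 h2 h3) h2 h3⟩
  obtain ⟨ψ, hψd, hinj, hgood, hemb⟩ := key k
  exact ⟨ψ, hψd, fun x hx x' hx' => hinj ⟨by have := hx.1; omega, hx⟩
    ⟨by have := hx'.1; omega, hx'⟩, fun x h2 h3 => hgood x (by omega) h2 h3,
    fun x h2 h3 => hemb x (by omega) h2 h3⟩

open Classical in
/-- The set of natural numbers below `k` with property `P`. -/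
noncomputable def subRange (k : ℕ) (P : ℕ → Prop) : Finset ℕ := {x ∈ range k | P x}

theorem mem_subRange {k x : ℕ} {P : ℕ → Prop} : x ∈ subRange k P ↔ x < k ∧ P x := by
  simp [subRange]

theorem subRange_congr {k : ℕ} {P Q : ℕ → Prop} (h : ∀ x < k, (P x ↔ Q x)) :
    subRange k P = subRange k Q := by
  ext x
  rw [mem_subRange, mem_subRange]
  exact and_congr_right fun hx => h x hx

theorem card_subRange_le (k : ℕ) (P : ℕ → Prop) : #(subRange k P) ≤ k := by
  classical exact (card_filter_le _ _).trans (card_range k).le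

theorem card_subRange_add {k : ℕ} {P Q T : ℕ → Prop} (h : ∀ x < k, (P x ↔ Q x ∨ T x))
    (h' : ∀ x < k, Q x → ¬ T x) :
    (#(subRange k P) : ℝ) = #(subRange k Q) + #(subRange k T) := by
  classical
  rw [← Nat.cast_add, ← card_union_of_disjoint]
  · congr 2
    ext x
    simp only [mem_subRange, mem_union]
    constructor
    · rintro ⟨h1, h2⟩
      exact ((h x h1).1 h2).imp (⟨h1, ·⟩) (⟨h1, ·⟩)
    · rintro (⟨h1, h2⟩ | ⟨h1, h2⟩)
      · exact ⟨h1, (h x h1).2 (Or.inl h2)⟩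
      · exact ⟨h1, (h x h1).2 (Or.inr h2)⟩
  · rw [Finset.disjoint_left]
    intro x hx hx'
    rw [mem_subRange] at hx hx'
    exact h' x hx.1 hx.2 hx'.2

theorem card_subRange_and_add_not (k : ℕ) (P A : ℕ → Prop) :
    (#(subRange k P) : ℝ) = #(subRange k fun x => P x ∧ A x)
      + #(subRange k fun x => P x ∧ ¬ A x) :=
  card_subRange_add (fun x _ => by tauto) fun x _ => by tauto

theorem sub_div_split (l x P p Q q Y Z d : ℝ) :
    l + x - ((P + p) * Y + (Q + q) * Z) / d
      = l - (P * Y + Q * Z) / d + x - (p * Y + q * Z) / d := by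
  ring

theorem five_mul_add_sq_le {a b c : ℝ} (hc : 0 ≤ c) (hca : c ≤ a) :
    5 * a * b + 5 * c ^ 2 ≤ 5 * a * (b + c) := by
  nlinarith

set_option maxHeartbeats 1600000 in
open Classical in
/-- Embedding of a rooted tree, given with a decomposition into small pieces with roots `D`, into a
graph with a clustering: `Z` are small reserved sets used for piece roots only, `W` are the sets
used for all other vertices, `y` is a skew fractional matching on the reduced graph `R`, and `Vs` is
a set of vertices seeing almost all pairs of the skew matching. -/
theorem exists_tree_embedding {ι V : Type*} [Fintype ι] (G : SimpleGraph V)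
    (W Z : ι → Finset V) (v : ι) (Vs : Finset V) (R : ι → ι → Prop) (y : ι → ι → ℝ)
    {f g e₁ δ κ e : ℝ}
    (hWW : ∀ a b, a ≠ b → Disjoint (W a) (W b)) (hWZ : ∀ a b, Disjoint (W a) (Z b))
    (hR : ∀ c c', R c c' → ∀ F ⊆ W c' ∪ Z c', f ≤ #F →
      (#{x ∈ W c ∪ Z c | (#{z ∈ F | G.Adj x z} : ℝ) < g} : ℝ) ≤ e₁)
    (hVsZ : Vs ⊆ Z v) (hVsf : f ≤ #Vs)
    (hVs : ∀ s ∈ Vs, ∃ E : Finset ι, ∑ a ∈ E, ∑ b, y a b ≤ δ ∧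
      ∀ a, a ∉ E → ∀ b, 0 < y a b → g ≤ #{z ∈ Z a | G.Adj s z})
    (hy0 : ∀ a b, 0 ≤ y a b) (hy1 : ∑ a, ∑ b, y a b = 1)
    (hyR : ∀ a b, 0 < y a b → R a b ∧ R b a ∧ R a v ∧ R v a)
    (hδ0 : 0 ≤ δ) (hδ : δ ≤ 1 / 2)
    (par : ℕ → ℕ) (A : ℕ → Prop) (D : Finset ℕ) (k L : ℕ)
    (hpar : ∀ x < k, 0 < x → par x < x)
    (hA : ∀ x < k, 0 < x → (A x ↔ ¬ A (par x))) (hA0 : A 0)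
    (h0D : 0 ∈ D)
    (hL : ∀ d < k, #{x ∈ range k | pieceRoot par (D : Set ℕ) x = d} ≤ L)
    (hDpar : ∀ d ∈ D, 0 < d → ¬ A d → par d ∈ D)
    (hload : ∀ c, (#(subRange k fun x => ¬ A x) : ℝ) * ∑ b, y c b
      + (#(subRange k A) : ℝ) * ∑ a, y a c ≤ κ)
    (he0 : 0 ≤ e) (he : 5 * (L : ℝ) * k ≤ e ^ 2)
    (hcap : ∀ c, κ / (1 - δ) + e + f ≤ #(W c)) (hgf : g ≤ f)
    (hnumD : 2 * e₁ + #D < g) (hnumL : 2 * e₁ + L < g) :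
    ∃ φ : ℕ → V, Set.InjOn φ {x | x < k} ∧
      ∀ x < k, 0 < x → G.Adj (φ (par x)) (φ x) := by
  set rt := pieceRoot par (D : Set ℕ) with hrt
  have hrtD : ∀ x < k, rt x ∈ D := fun x hx => mem_coe.1 (pieceRoot_mem hpar (mem_coe.2 h0D) hx)
  have hrtself : ∀ x ∈ D, rt x = x := fun x hx => pieceRoot_of_mem (mem_coe.2 hx)
  have hrtle : ∀ x, rt x ≤ x := pieceRoot_le par _
  have hδ1 : 0 < 1 - δ := by linarith
  have hyo : ∀ c, 0 ≤ ∑ b, y c b := fun c => sum_nonneg fun b _ => hy0 _ _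
  have hyi : ∀ c, 0 ≤ ∑ a, y a c := fun c => sum_nonneg fun b _ => hy0 _ _
  have hL0 : (0 : ℝ) ≤ L := Nat.cast_nonneg L
  have hD0 : (0 : ℝ) ≤ #D := Nat.cast_nonneg _
  have hVsne : Vs.Nonempty := by
    by_contra h
    rw [not_nonempty_iff_eq_empty] at h
    rw [h] at hVsf
    simp at hVsf
    have : ∃ a, ∃ b, 0 < y a b := by
      by_contra hcon
      push Not at hcon
      have : ∑ a, ∑ b, y a b ≤ 0 := sum_nonpos fun a _ => sum_nonpos fun b _ => hcon a b
      linarith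
    obtain ⟨a, b, hab⟩ := this
    have h2 := hR a b (hyR a b hab).1 (W b ∪ Z b) (Subset.refl _) (hVsf.trans (Nat.cast_nonneg _))
    have h3 : (0 : ℝ) ≤ e₁ := (Nat.cast_nonneg _).trans h2
    linarith
  have key : ∀ j ≤ k, ∃ φ : ℕ → V, ∃ ld : ι → ℝ,
      Set.InjOn φ {x | x < k ∧ rt x < j} ∧
      (∀ x, x < k → rt x < j → 0 < x → G.Adj (φ (par x)) (φ x)) ∧
      (∀ x, x < k → rt x < j → ¬ A x → g ≤ #{z ∈ Vs | G.Adj (φ x) z}) ∧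
      (∀ x, x < k → rt x < j → x ∈ D → A x → φ x ∈ Vs) ∧
      (∀ x, x < k → rt x < j → x ∈ D → ∃ c, φ x ∈ Z c) ∧
      (∀ x, x < k → rt x < j → x ∉ D → ∃ c, φ x ∈ W c) ∧
      (∀ c, (#(subRange k fun x => rt x < j ∧ x ∉ D ∧ φ x ∈ W c) : ℝ) ≤ ld c) ∧
      ∑ c, (max 0 (ld c - ((#(subRange k fun x => rt x < j ∧ ¬ A x) : ℝ) * ∑ b, y c b
        + (#(subRange k fun x => rt x < j ∧ A x) : ℝ) * ∑ a, y a c) / (1 - δ))) ^ 2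
        ≤ 5 * L * (#(subRange k fun x => rt x < j) : ℝ) := by
    intro j
    induction j with
    | zero =>
      intro _
      refine ⟨fun _ => hVsne.choose, fun _ => 0, ?_⟩
      have h0 : ∀ P : ℕ → Prop, subRange k (fun x => rt x < 0 ∧ P x) = ∅ := fun P =>
        eq_empty_of_forall_notMem fun x hx => by simp [mem_subRange] at hx
      have h0' : subRange k (fun x => rt x < 0) = ∅ :=
        eq_empty_of_forall_notMem fun x hx => by simp [mem_subRange] at hx
      simp only [h0, h0']
      simp
    | succ j ih =>
      intro hjk
      obtain ⟨φ, ld, i1, i2, i3, i4, i5, i6, i7, i8⟩ := ih (by omega)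
      by_cases hjD : j ∈ D
      swap
      · have hiff : ∀ x < k, (rt x < j + 1 ↔ rt x < j) := by
          intro x hx
          have : rt x ≠ j := fun h => hjD (h ▸ hrtD x hx)
          omega
        have hfil : ∀ p : ℕ → Prop, (subRange k fun x => rt x < j + 1 ∧ p x)
            = subRange k fun x => rt x < j ∧ p x := fun p => subRange_congr fun x hx => by
          rw [hiff x hx]
        have hfil' : (subRange k fun x => rt x < j + 1)
            = subRange k fun x => rt x < j := subRange_congr fun x hx => by
          rw [hiff x hx]
        refine ⟨φ, ld, fun x hx x' hx' => i1 ⟨hx.1, (hiff x hx.1).1 hx.2⟩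
          ⟨hx'.1, (hiff x' hx'.1).1 hx'.2⟩, fun x h1 h2 => i2 x h1 ((hiff x h1).1 h2),
          fun x h1 h2 => i3 x h1 ((hiff x h1).1 h2), fun x h1 h2 => i4 x h1 ((hiff x h1).1 h2),
          fun x h1 h2 => i5 x h1 ((hiff x h1).1 h2), fun x h1 h2 => i6 x h1 ((hiff x h1).1 h2),
          fun c => ?_, ?_⟩
        · rw [hfil]; exact i7 c
        · simp only [hfil, hfil']; exact i8
      -- the piece with root `j`
      have hjk' : j < k := hjk
      have hrtj := hrtself j hjD
      set S : Finset ℕ := subRange k fun x => rt x < j with hS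
      set K : Finset ℕ := subRange k fun x => rt x = j with hK
      have hKL : #K ≤ L := by
        refine (card_le_card fun x hx => ?_).trans (hL j hjk')
        rw [hK, mem_subRange] at hx
        exact mem_filter.2 ⟨mem_range.2 hx.1, hx.2⟩
      set p : ℝ := (#(subRange k fun x => rt x = j ∧ ¬ A x) : ℝ) with hp
      set q : ℝ := (#(subRange k fun x => rt x = j ∧ A x) : ℝ) with hq
      have hpq : p + q = #K := by
        rw [add_comm]
        exact (card_subRange_and_add_not k _ _).symm
      -- free space
      have hld : ∀ c, ld c ≤ κ / (1 - δ) + e := by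
        intro c
        set tg := ((#(subRange k fun x => rt x < j ∧ ¬ A x) : ℝ) * ∑ b, y c b
          + (#(subRange k fun x => rt x < j ∧ A x) : ℝ) * ∑ a, y a c) / (1 - δ) with htg
        have h1 : tg ≤ κ / (1 - δ) := by
          refine div_le_div_of_nonneg_right (le_trans ?_ (hload c)) hδ1.le
          refine add_le_add (mul_le_mul_of_nonneg_right ?_ (hyo c))
            (mul_le_mul_of_nonneg_right ?_ (hyi c))
          · exact Nat.cast_le.2 (card_le_card fun x hx => by
              rw [mem_subRange] at hx ⊢; exact ⟨hx.1, hx.2.2⟩)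
          · exact Nat.cast_le.2 (card_le_card fun x hx => by
              rw [mem_subRange] at hx ⊢; exact ⟨hx.1, hx.2.2⟩)
        have h2 : (max 0 (ld c - tg)) ^ 2 ≤ e ^ 2 := by
          refine le_trans (single_le_sum (f := fun c => (max 0 (ld c -
            ((#(subRange k fun x => rt x < j ∧ ¬ A x) : ℝ) * ∑ b, y c b
            + (#(subRange k fun x => rt x < j ∧ A x) : ℝ) * ∑ a, y a c) / (1 - δ))) ^ 2)
            (fun c _ => sq_nonneg _) (mem_univ c)) (i8.trans (le_trans ?_ he))
          refine mul_le_mul_of_nonneg_left ?_ (by positivity)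
          exact_mod_cast card_subRange_le _ _
        have h3 := (le_abs_self _).trans (abs_le_of_sq_le_sq h2 he0)
        have h4 := le_max_right 0 (ld c - tg)
        linarith
      have hfree : ∀ c, f ≤ #(W c \ S.image φ) := by
        intro c
        have h1 : #(W c) ≤ #(W c \ S.image φ)
            + #(subRange k fun x => rt x < j ∧ x ∉ D ∧ φ x ∈ W c) := by
          have : W c ⊆ (W c \ S.image φ) ∪
              (subRange k fun x => rt x < j ∧ x ∉ D ∧ φ x ∈ W c).image φ := by
            intro z hz
            by_cases h : z ∈ S.image φ
            · refine mem_union_right _ ?_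
              obtain ⟨x, hx, rfl⟩ := mem_image.1 h
              refine mem_image_of_mem _ ?_
              simp only [hS, mem_subRange] at hx ⊢
              refine ⟨hx.1, hx.2, fun hxD => ?_, hz⟩
              obtain ⟨c', hc'⟩ := i5 x hx.1 hx.2 hxD
              exact disjoint_left.1 (hWZ c c') hz hc'
            · exact mem_union_left _ (mem_sdiff.2 ⟨hz, h⟩)
          exact (card_le_card this).trans ((card_union_le _ _).trans
            (Nat.add_le_add_left card_image_le _))
        have h2 : (#(W c) : ℝ) ≤ #(W c \ S.image φ)
            + #(subRange k fun x => rt x < j ∧ x ∉ D ∧ φ x ∈ W c) := by exact_mod_cast h1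
        have := i7 c
        have := hld c
        have := hcap c
        linarith
      -- choice of the pair of clusters
      have hpair : ∃ a b, 0 < y a b ∧
          (0 < j → ¬ A j → g ≤ #{z ∈ Z a | G.Adj (φ (par j)) z}) ∧
          ∑ c, (max 0 (ld c - ((#(subRange k fun x => rt x < j ∧ ¬ A x) : ℝ) * ∑ b, y c b
            + (#(subRange k fun x => rt x < j ∧ A x) : ℝ) * ∑ a, y a c) / (1 - δ)
            + ((if a = c then p else 0) + if b = c then q else 0)
            - (p * ∑ b, y c b + q * ∑ a, y a c) / (1 - δ))) ^ 2
            ≤ 5 * L * (#S : ℝ) + 5 * (p + q) ^ 2 := by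
        have hE : ∃ E : Finset ι, ∑ a ∈ E, ∑ b, y a b ≤ δ ∧ ∀ a, a ∉ E → ∀ b, 0 < y a b →
            (0 < j → ¬ A j → g ≤ #{z ∈ Z a | G.Adj (φ (par j)) z}) := by
          by_cases hj : 0 < j ∧ ¬ A j
          · have hpD := hDpar j hjD hj.1 hj.2
            have hpj := hpar j hjk' hj.1
            obtain ⟨E, h1, h2⟩ := hVs (φ (par j)) (i4 (par j) (hpj.trans hjk')
              (by rw [hrtself _ hpD]; exact hpj) hpD
              (not_not.1 fun h => hj.2 ((hA j hjk' hj.1).2 h)))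
            exact ⟨E, h1, fun a ha b hab _ _ => h2 a ha b hab⟩
          · exact ⟨∅, by simpa using hδ0, fun a _ b _ h1 h2 => absurd ⟨h1, h2⟩ hj⟩
        obtain ⟨E, h1, h2⟩ := hE
        obtain ⟨a, b, haE, hab, h3⟩ := exists_balanced_pair y hy0 hy1 E hδ h1
          (p := p) (q := q) (Nat.cast_nonneg _) (Nat.cast_nonneg _)
          (fun c => ld c - ((#(subRange k fun x => rt x < j ∧ ¬ A x) : ℝ) * ∑ b, y c b
            + (#(subRange k fun x => rt x < j ∧ A x) : ℝ) * ∑ a, y a c) / (1 - δ))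
        exact ⟨a, b, hab, h2 a haE b hab, h3.trans (by linarith)⟩
      obtain ⟨a, b, hab, hroot, hpot⟩ := hpair
      obtain ⟨hRab, hRba, hRav, hRva⟩ := hyR a b hab
      set FB := W a \ S.image φ with hFB
      set FA := W b \ S.image φ with hFA
      set GA : V → Prop := fun x => g ≤ #{z ∈ FB | G.Adj x z} with hGA
      set GB : V → Prop := fun x => g ≤ #{z ∈ FA | G.Adj x z} ∧ g ≤ #{z ∈ Vs | G.Adj x z} with hGB
      have hbadA : ∀ c, R c a → (#{x ∈ W c ∪ Z c | ¬ GA x} : ℝ) ≤ e₁ := by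
        intro c hc
        simp only [hGA, not_le]
        exact hR c a hc FB (sdiff_subset.trans subset_union_left) (hfree a)
      have hbadB : (#{x ∈ W a ∪ Z a | ¬ GB x} : ℝ) ≤ 2 * e₁ := by
        have h1 := hR a b hRab FA (sdiff_subset.trans subset_union_left) (hfree b)
        have h2 := hR a v hRav Vs (hVsZ.trans subset_union_right) hVsf
        have h3 : #{x ∈ W a ∪ Z a | ¬ GB x} ≤
            #{x ∈ W a ∪ Z a | (#{z ∈ FA | G.Adj x z} : ℝ) < g}
            + #{x ∈ W a ∪ Z a | (#{z ∈ Vs | G.Adj x z} : ℝ) < g} := by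
          refine (card_le_card fun x hx => ?_).trans (card_union_le _ _)
          simp only [hGB, mem_filter, mem_union (s := filter _ _), not_and_or, not_le] at hx ⊢
          exact hx.2.imp (⟨hx.1, ·⟩) (⟨hx.1, ·⟩)
        have h4 : (#{x ∈ W a ∪ Z a | ¬ GB x} : ℝ) ≤
            #{x ∈ W a ∪ Z a | (#{z ∈ FA | G.Adj x z} : ℝ) < g}
            + #{x ∈ W a ∪ Z a | (#{z ∈ Vs | G.Adj x z} : ℝ) < g} := by exact_mod_cast h3
        linarith
      have he₁0 : 0 ≤ e₁ := (Nat.cast_nonneg _).trans (hbadA b hRba)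
      -- placing the root
      have hz₀ : ∃ z₀, (0 < j → G.Adj (φ (par j)) z₀) ∧ (A j → z₀ ∈ Vs) ∧ (∃ c, z₀ ∈ Z c) ∧
          z₀ ∉ S.image φ ∧ (A j → GA z₀) ∧ (¬ A j → GB z₀) := by
        set U := (D.filter fun x => x < k ∧ rt x < j).image φ with hU
        have hUD : (#U : ℝ) ≤ #D := by
          exact_mod_cast card_image_le.trans (card_filter_le _ _)
        have hUS : ∀ z, (∃ c, z ∈ Z c) → z ∉ U → z ∉ S.image φ := by
          rintro z ⟨c, hc⟩ hzU hzS
          obtain ⟨x, hx, rfl⟩ := mem_image.1 hzS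
          rw [hS, mem_subRange] at hx
          by_cases hxD : x ∈ D
          · exact hzU (mem_image_of_mem _ (mem_filter.2 ⟨hxD, hx⟩))
          · obtain ⟨c', hc'⟩ := i6 x hx.1 hx.2 hxD
            exact disjoint_left.1 (hWZ c' c) hc' hc
        by_cases hAj : A j
        · have hC : ∃ C ⊆ Vs, g ≤ #C ∧ (0 < j → ∀ z ∈ C, G.Adj (φ (par j)) z) := by
            rcases Nat.eq_zero_or_pos j with h | h
            · exact ⟨Vs, Subset.refl _, hgf.trans hVsf, fun h' => by omega⟩
            · have hpj := hpar j hjk' h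
              refine ⟨{z ∈ Vs | G.Adj (φ (par j)) z}, filter_subset _ _,
                i3 (par j) (hpj.trans hjk') ((hrtle _).trans_lt hpj) ((hA j hjk' h).1 hAj),
                fun _ z hz => (mem_filter.1 hz).2⟩
          obtain ⟨C, hC1, hC2, hC3⟩ := hC
          obtain ⟨z, hz, hzb, hzU⟩ := exists_mem_notMem_of_card hC2 (hbadA v hRva) hUD
            (by linarith)
          have hzZ := hVsZ (hC1 hz)
          refine ⟨z, fun h => hC3 h z hz, fun _ => hC1 hz, ⟨v, hzZ⟩, hUS z ⟨v, hzZ⟩ hzU,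
            fun _ => ?_, fun h => absurd hAj h⟩
          by_contra h
          exact hzb (mem_filter.2 ⟨mem_union_right _ hzZ, h⟩)
        · have hj0 : 0 < j := Nat.pos_of_ne_zero fun h => hAj (h ▸ hA0)
          obtain ⟨z, hz, hzb, hzU⟩ := exists_mem_notMem_of_card (hroot hj0 hAj) hbadB hUD hnumD
          rw [mem_filter] at hz
          refine ⟨z, fun _ => hz.2, fun h => absurd h hAj, ⟨a, hz.1⟩, hUS z ⟨a, hz.1⟩ hzU,
            fun h => absurd h hAj, fun _ => ?_⟩
          by_contra h
          exact hzb (mem_filter.2 ⟨mem_union_right _ hz.1, h⟩)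
      obtain ⟨z₀, hz1, hz2, hz3, hz4, hz5, hz6⟩ := hz₀
      obtain ⟨ψ, hψj, hψinj, hψgood, hψ⟩ := exists_piece_embedding G par A (D : Set ℕ) k j L
        (mem_coe.2 h0D) hpar hA (hL j hjk') z₀ FA FB GA GB hz5 hz6
        (by
          intro x hx U hU
          obtain ⟨z, hz, hzb, hzU⟩ := exists_mem_notMem_of_card hx hbadB
            (Nat.cast_le.2 hU : (#U : ℝ) ≤ L) hnumL
          rw [mem_filter] at hz
          refine ⟨z, hz.1, hzU, hz.2, ?_⟩
          by_contra h
          exact hzb (mem_filter.2 ⟨mem_union_left _ (mem_sdiff.1 hz.1).1, h⟩))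
        (by
          intro x hx U hU
          obtain ⟨z, hz, hzb, hzU⟩ := exists_mem_notMem_of_card hx.1 (hbadA b hRba)
            (Nat.cast_le.2 hU : (#U : ℝ) ≤ L) (by linarith)
          rw [mem_filter] at hz
          refine ⟨z, hz.1, hzU, hz.2, ?_⟩
          by_contra h
          exact hzb (mem_filter.2 ⟨mem_union_left _ (mem_sdiff.1 hz.1).1, h⟩))
      change Set.InjOn ψ {x | x < k ∧ rt x = j} at hψinj
      change ∀ x, x < k → rt x = j → _ at hψgood
      change ∀ x, x < k → rt x = j → _ at hψ
      have hKD : ∀ x, rt x = j → (x ∉ D ↔ x ≠ j) := by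
        intro x hx
        constructor
        · rintro h rfl; exact h hjD
        · intro h hxD; exact h (by rw [← hx, hrtself x hxD])
      set φ' : ℕ → V := fun x => if rt x = j then ψ x else φ x with hφ'
      have hφK : ∀ x, rt x = j → φ' x = ψ x := fun x hx => if_pos hx
      have hφS : ∀ x, rt x < j → φ' x = φ x := fun x hx => if_neg hx.ne
      have hψS : ∀ x, x < k → rt x = j → ψ x ∉ S.image φ := by
        intro x hx hxj
        by_cases h : x = j
        · rw [h, hψj]; exact hz4
        · have := hψ x hx hxj h
          by_cases hAx : A x
          · exact (mem_sdiff.1 (this.1 hAx)).2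
          · exact (mem_sdiff.1 (this.2.1 hAx)).2
      have hcase : ∀ x, rt x < j + 1 → rt x = j ∨ rt x < j := fun x hx => by omega
      have hmemS : ∀ x, x < k → rt x < j → x ∈ S := fun x h1 h2 =>
        mem_subRange.2 ⟨h1, h2⟩
      have hcard : ∀ P : ℕ → Prop, (#(subRange k fun x => rt x < j + 1 ∧ P x) : ℝ)
          = #(subRange k fun x => rt x < j ∧ P x) + #(subRange k fun x => rt x = j ∧ P x) := by
        intro P
        refine card_subRange_add (fun x _ => ?_) fun x _ h1 h2 => by omega
        rw [show rt x < j + 1 ↔ rt x < j ∨ rt x = j by omega]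
        exact or_and_right
      refine ⟨φ', fun c => ld c + ((if a = c then p else 0) + if b = c then q else 0),
        ?_, ?_, ?_, ?_, ?_, ?_, ?_, ?_⟩
      · rintro x ⟨hx, hxj⟩ x' ⟨hx', hxj'⟩ h
        rcases hcase x hxj with hxj | hxj <;> rcases hcase x' hxj' with hxj' | hxj'
        · rw [hφK x hxj, hφK x' hxj'] at h
          exact hψinj ⟨hx, hxj⟩ ⟨hx', hxj'⟩ h
        · rw [hφK x hxj, hφS x' hxj'] at h
          exact absurd (h ▸ mem_image_of_mem φ (hmemS x' hx' hxj')) (hψS x hx hxj)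
        · rw [hφS x hxj, hφK x' hxj'] at h
          exact absurd (h ▸ mem_image_of_mem φ (hmemS x hx hxj)) (hψS x' hx' hxj')
        · rw [hφS x hxj, hφS x' hxj'] at h
          exact i1 ⟨hx, hxj⟩ ⟨hx', hxj'⟩ h
      · intro x hx hxj hx0
        have hpx := hpar x hx hx0
        rcases hcase x hxj with hxj | hxj
        · rw [hφK x hxj]
          by_cases h : x = j
          · rw [hφS (par x) ((hrtle _).trans_lt (h ▸ hpx)), h, hψj]
            exact hz1 (h ▸ hx0)
          · have hxD : x ∉ D := (hKD x hxj).2 h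
            have : rt (par x) = j := by
              rw [← hxj]; exact (pieceRoot_of_notMem hpx (by simpa using hxD)).symm
            rw [hφK _ this]
            exact (hψ x hx hxj h).2.2
        · rw [hφS x hxj, hφS (par x)]
          · exact i2 x hx hxj hx0
          · by_cases hxD : x ∈ D
            · rw [hrtself x hxD] at hxj
              exact (hrtle _).trans_lt (hpx.trans hxj)
            · have h1 : rt x = rt (par x) := pieceRoot_of_notMem hpx (by simpa using hxD)
              rwa [← h1]
      · intro x hx hxj hAx
        rcases hcase x hxj with hxj | hxj
        · rw [hφK x hxj]; exact ((hψgood x hx hxj).2 hAx).2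
        · rw [hφS x hxj]; exact i3 x hx hxj hAx
      · intro x hx hxj hxD hAx
        rcases hcase x hxj with hxj | hxj
        · rw [hφK x hxj]
          have : x = j := by rw [← hxj, hrtself x hxD]
          subst this
          rw [hψj]; exact hz2 hAx
        · rw [hφS x hxj]; exact i4 x hx hxj hxD hAx
      · intro x hx hxj hxD
        rcases hcase x hxj with hxj | hxj
        · rw [hφK x hxj]
          have : x = j := by rw [← hxj, hrtself x hxD]
          rw [this, hψj]; exact hz3
        · rw [hφS x hxj]; exact i5 x hx hxj hxD
      · intro x hx hxj hxD
        rcases hcase x hxj with hxj | hxj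
        · rw [hφK x hxj]
          have := hψ x hx hxj ((hKD x hxj).1 hxD)
          by_cases hAx : A x
          · exact ⟨b, (mem_sdiff.1 (this.1 hAx)).1⟩
          · exact ⟨a, (mem_sdiff.1 (this.2.1 hAx)).1⟩
        · rw [hφS x hxj]; exact i6 x hx hxj hxD
      · intro c
        rw [hcard]
        refine add_le_add (le_trans (le_of_eq ?_) (i7 c)) ?_
        · congr 2
          refine subRange_congr fun x _ => and_congr_right fun hx => ?_
          rw [hφS x hx]
        · have hsub : #(subRange k fun x => rt x = j ∧ x ∉ D ∧ φ' x ∈ W c) ≤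
              #(if a = c then (subRange k fun x => rt x = j ∧ ¬ A x) else ∅)
                + #(if b = c then (subRange k fun x => rt x = j ∧ A x) else ∅) := by
            refine (card_le_card fun x hx => ?_).trans (card_union_le _ _)
            rw [mem_subRange] at hx
            obtain ⟨hxk, hxj, hxD, hxW⟩ := hx
            rw [hφK x hxj] at hxW
            have h1 := hψ x hxk hxj ((hKD x hxj).1 hxD)
            by_cases hAx : A x
            · have : b = c := by
                by_contra hne
                exact disjoint_left.1 (hWW b c hne) (mem_sdiff.1 (h1.1 hAx)).1 hxW
              rw [mem_union, if_pos this]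
              exact Or.inr (mem_subRange.2 ⟨hxk, hxj, hAx⟩)
            · have : a = c := by
                by_contra hne
                exact disjoint_left.1 (hWW a c hne) (mem_sdiff.1 (h1.2.1 hAx)).1 hxW
              rw [mem_union, if_pos this]
              exact Or.inl (mem_subRange.2 ⟨hxk, hxj, hAx⟩)
          have h2 : (#(subRange k fun x => rt x = j ∧ x ∉ D ∧ φ' x ∈ W c) : ℝ) ≤
              #(if a = c then (subRange k fun x => rt x = j ∧ ¬ A x) else ∅)
              + #(if b = c then (subRange k fun x => rt x = j ∧ A x) else ∅) := by exact_mod_cast hsub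
          refine h2.trans (le_of_eq ?_)
          congr 1
          · split_ifs <;> simp [hp]
          · split_ifs <;> simp [hq]
      · have hSK : (#(subRange k fun x => rt x < j + 1) : ℝ) = #S + #K := by
          refine card_subRange_add (fun x _ => ?_) fun x _ h1 h2 => by omega
          omega
        rw [hSK]
        refine le_trans (le_of_eq ?_) (hpot.trans ?_)
        · refine sum_congr rfl fun c _ => ?_
          rw [hcard, hcard]
          congr 2
          exact sub_div_split _ _ _ _ _ _ _ _ _
        · have h1 : (#K : ℝ) ≤ L := Nat.cast_le.2 hKL
          rw [hpq]
          exact five_mul_add_sq_le (Nat.cast_nonneg _) h1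
  obtain ⟨φ, -, i1, i2, -⟩ := key k le_rfl
  have hlt : ∀ x < k, rt x < k := fun x hx => (hrtle x).trans_lt hx
  exact ⟨φ, fun x hx x' hx' => i1 ⟨hx, hlt x hx⟩ ⟨hx', hlt x' hx'⟩,
    fun x hx h0 => i2 x hx (hlt x hx) h0⟩

open Classical in
/-- In a uniform pair, few vertices have few neighbours in a large subset of the other side. -/
theorem card_atypical_le {V : Type*} (G : SimpleGraph V) {ε d : ℝ} {C C' F : Finset V}
    (hu : G.IsUniform ε C C') (hd : d ≤ (G.edgeDensity C C' : ℝ)) (hF : F ⊆ C')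
    (hFc : (#C' : ℝ) * ε ≤ #F) :
    (#{x ∈ C | (#{z ∈ F | G.Adj x z} : ℝ) < (d - ε) * #F} : ℝ) ≤ #C * ε := by
  by_contra! hlt
  set X := {x ∈ C | (#{z ∈ F | G.Adj x z} : ℝ) < (d - ε) * #F} with hX
  have h1 := hu (filter_subset _ C) hF hlt.le hFc
  have hε := hu.pos
  have hXpos : (0 : ℝ) < #X := lt_of_le_of_lt (by positivity) hlt
  have hXne : X.Nonempty := card_pos.1 (by exact_mod_cast hXpos)
  have h2 : (#(G.interedges X F) : ℝ) < (d - ε) * #F * #X := by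
    have h3 : #(G.interedges X F) = ∑ x ∈ X, #{z ∈ F | G.Adj x z} := by
      rw [interedges_def, card_filter, sum_product]
      exact sum_congr rfl fun x _ => (card_filter _ _).symm
    rw [h3, Nat.cast_sum]
    calc ∑ x ∈ X, (#{z ∈ F | G.Adj x z} : ℝ) < ∑ _x ∈ X, (d - ε) * #F :=
          sum_lt_sum_of_nonempty hXne fun x hx => (mem_filter.1 hx).2
      _ = _ := by rw [sum_const, nsmul_eq_mul, mul_comm]
  have hFpos : (0 : ℝ) < #F := by
    rcases (Nat.cast_nonneg (α := ℝ) #F).eq_or_lt with h | h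
    · rw [← h] at h2
      have : (0 : ℝ) ≤ #(G.interedges X F) := Nat.cast_nonneg _
      simp at h2
      linarith
    · exact h
  have h4 : (G.edgeDensity X F : ℝ) < d - ε := by
    rw [edgeDensity_def]
    push_cast
    rw [div_lt_iff₀ (by positivity)]
    linarith
  have := (abs_lt.1 h1).1
  linarith

theorem reduced_density_bound {η ε d K n m t u r : ℝ} (hη : 0 < η) (hη1 : η ≤ 1)
    (hε : ε ≤ η / 32) (hd : d ≤ η / 8) (hm : 48 ≤ η * m) (ht : 32 ≤ η * t) (hu : u ≤ t ^ 2 * ε)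
    (hr : r ≤ t ^ 2) (hr0 : 0 ≤ r) (hmt : m * t ≤ n)
    (h : (K + η * n) * n ≤ (t + u + r) * (m + 1) ^ 2 + d * n ^ 2) :
    (K + η / 2 * n) * t ≤ m * r := by
  have hm0 : 0 < m := pos_of_mul_pos_right (by linarith : 0 < η * m) hη.le
  have ht0 : 0 < t := pos_of_mul_pos_right (by linarith : 0 < η * t) hη.le
  have hmt0 : 0 < m * t := mul_pos hm0 ht0
  have hn2 : (m * t) ^ 2 ≤ n ^ 2 := pow_le_pow_left₀ hmt0.le hmt 2
  have hm1 : 1 ≤ m := by nlinarith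
  have h1 : (m + 1) ^ 2 ≤ m ^ 2 + η / 16 * m ^ 2 := by nlinarith
  have h2 : r * (m + 1) ^ 2 ≤ r * m ^ 2 + η / 16 * n ^ 2 := by
    calc r * (m + 1) ^ 2 ≤ r * (m ^ 2 + η / 16 * m ^ 2) := mul_le_mul_of_nonneg_left h1 hr0
      _ = r * m ^ 2 + r * (η / 16 * m ^ 2) := by ring
      _ ≤ r * m ^ 2 + t ^ 2 * (η / 16 * m ^ 2) := by gcongr
      _ = r * m ^ 2 + η / 16 * (m * t) ^ 2 := by ring
      _ ≤ _ := by gcongr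
  have h3 : t + u ≤ η / 16 * t ^ 2 := by
    have h4 : t ^ 2 * ε ≤ t ^ 2 * (η / 32) := by gcongr
    nlinarith
  have h5 : (t + u) * (m + 1) ^ 2 ≤ η / 8 * n ^ 2 := by
    calc (t + u) * (m + 1) ^ 2 ≤ η / 16 * t ^ 2 * (m + 1) ^ 2 := by gcongr
      _ ≤ η / 16 * t ^ 2 * (2 * m ^ 2) := by
        gcongr
        nlinarith
      _ = η / 8 * (m * t) ^ 2 := by ring
      _ ≤ _ := by gcongr
  have h6 : d * n ^ 2 ≤ η / 8 * n ^ 2 := by gcongr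
  have h7 : (K + η / 2 * n) * n ≤ r * m ^ 2 := by nlinarith [sq_nonneg n]
  rcases le_or_gt 0 (K + η / 2 * n) with h8 | h8
  · have h9 : (K + η / 2 * n) * t * m ≤ m * r * m := by
      calc (K + η / 2 * n) * t * m = (K + η / 2 * n) * (m * t) := by ring
        _ ≤ (K + η / 2 * n) * n := by gcongr
        _ ≤ _ := by linarith
    exact le_of_mul_le_mul_right h9 hm0
  · nlinarith [mul_nonneg hm0.le hr0]

open Classical in
/-- Szemerédi's regularity lemma, in the form of a reduced graph `R` on a bounded number of clusters
which inherits the edge density of the original graph. -/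
theorem exists_reduced_graph {η ε d : ℝ} (hη : 0 < η) (hη1 : η ≤ 1) (hε : 0 < ε) (hεη : ε ≤ η / 32)
    (hd0 : 0 ≤ d) (hd : d ≤ η / 8) :
    ∃ M n₀ : ℕ, 0 < M ∧ ∀ (V : Type) [Fintype V] (G : SimpleGraph V) (n : ℕ) (K : ℝ),
      Fintype.card V = n → n₀ ≤ n → (K + η * n) * n ≤ ∑ v, (G.degree v : ℝ) →
      ∃ (ι : Type) (_ : Fintype ι) (C : ι → Finset V) (R : ι → ι → Prop) (m : ℕ),
        0 < m ∧ 0 < Fintype.card ι ∧ n ≤ 2 * M * m ∧ Fintype.card ι ≤ M ∧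
        m * Fintype.card ι ≤ n ∧
        (∀ c, m ≤ #(C c) ∧ #(C c) ≤ m + 1) ∧ (∀ a b, a ≠ b → Disjoint (C a) (C b)) ∧
        (∀ a b, R a b → R b a) ∧
        (K + η / 2 * n) * Fintype.card ι ≤ m * ∑ c, (#{c' | R c c'} : ℝ) ∧
        ∀ c c', R c c' → ∀ F ⊆ C c', (#(C c') : ℝ) * ε ≤ #F →
          (#{x ∈ C c | (#{z ∈ F | G.Adj x z} : ℝ) < (d - ε) * #F} : ℝ) ≤ #(C c) * ε := by
  set l : ℕ := ⌈32 / η⌉₊ with hl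
  set M := SzemerediRegularity.bound ε l with hM
  have hMpos : 0 < M := SzemerediRegularity.bound_pos ε l
  set B : ℕ := ⌈48 / η⌉₊ with hB
  have hlη : 32 ≤ η * l := by
    have := Nat.le_ceil (32 / η)
    rw [div_le_iff₀ hη] at this
    linarith
  have hBη : 48 ≤ η * B := by
    have := Nat.le_ceil (48 / η)
    rw [div_le_iff₀ hη] at this
    linarith
  have hB0 : 0 < B := Nat.ceil_pos.2 (by positivity)
  refine ⟨M, M * B + l, hMpos, fun V _ G n K hV hn hdeg => ?_⟩
  obtain ⟨P, hPe, hPl, hPM, hPu⟩ := szemeredi_regularity (l := l) G hε (by omega)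
  set t := #P.parts with ht
  have ht0 : 0 < t := lt_of_lt_of_le (Nat.ceil_pos.2 (by positivity)) hPl
  set m := n / t with hm
  have hsz : ∀ c ∈ P.parts, m ≤ #c ∧ #c ≤ m + 1 := fun c hc => by
    have h1 := hPe.average_le_card_part hc
    have h2 := hPe.card_part_le_average_add_one hc
    rw [card_univ, hV] at h1 h2
    exact ⟨h1, h2⟩
  have hBm : B ≤ m := by
    rw [hm, Nat.le_div_iff_mul_le ht0]
    calc B * t ≤ B * M := Nat.mul_le_mul_left _ hPM
      _ ≤ n := by rw [mul_comm]; omega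
  have hmt : m * t ≤ n := Nat.div_mul_le_self n t
  have hm0 : 0 < m := hB0.trans_le hBm
  have hnM : n ≤ 2 * M * m := by
    have h1 : n < t * (m + 1) := Nat.lt_mul_div_succ n ht0
    have h2 : t * (m + 1) ≤ M * (2 * m) := Nat.mul_le_mul hPM (by omega)
    linarith
  set R : Finset V → Finset V → Prop := fun c c' =>
    c ≠ c' ∧ G.IsUniform ε c c' ∧ d ≤ (G.edgeDensity c c' : ℝ) with hR
  have hcount : (∑ v, (G.degree v : ℝ)) ≤ ∑ p ∈ P.parts ×ˢ P.parts, (#(G.interedges p.1 p.2) : ℝ) := by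
    have h1 : ∑ v, G.degree v = #{e : V × V | G.Adj e.1 e.2} := by
      rw [card_filter, ← univ_product_univ, sum_product]
      refine sum_congr rfl fun v _ => ?_
      rw [← card_filter, ← G.card_neighborFinset_eq_degree, G.neighborFinset_eq_filter]
    have h2 : ({e : V × V | G.Adj e.1 e.2} : Finset _) ⊆
        (P.parts ×ˢ P.parts).biUnion fun p => G.interedges p.1 p.2 := by
      rintro ⟨x, y⟩ hxy
      obtain ⟨U, hU, hxU⟩ := P.exists_mem (mem_univ x)
      obtain ⟨W, hW, hyW⟩ := P.exists_mem (mem_univ y)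
      exact mem_biUnion.2 ⟨(U, W), mem_product.2 ⟨hU, hW⟩,
        G.mk_mem_interedges_iff.2 ⟨hxU, hyW, (mem_filter.1 hxy).2⟩⟩
    have h3 := (card_le_card h2).trans card_biUnion_le
    rw [← h1] at h3
    exact_mod_cast h3
  have hpair : ∀ p ∈ P.parts ×ˢ P.parts, (#(G.interedges p.1 p.2) : ℝ) ≤
      ((if p.1 = p.2 then (1 : ℝ) else 0) + (if p ∈ P.nonUniforms G ε then (1 : ℝ) else 0)
      + (if R p.1 p.2 then (1 : ℝ) else 0)) * ((m : ℝ) + 1) ^ 2 + d * ((#p.1 : ℝ) * #p.2) := by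
    rintro ⟨c, c'⟩ hp
    obtain ⟨hc, hc'⟩ := mem_product.1 hp
    dsimp only at hc hc' ⊢
    have h1 : (#(G.interedges c c') : ℝ) ≤ ((m : ℝ) + 1) ^ 2 := by
      have := (G.card_interedges_le_mul c c').trans (Nat.mul_le_mul (hsz c hc).2 (hsz c' hc').2)
      rw [sq]
      exact_mod_cast this
    have h2 : 0 ≤ d * ((#c : ℝ) * #c') := by positivity
    have h3 : (0 : ℝ) ≤ ((m : ℝ) + 1) ^ 2 := by positivity
    have h5 : ∀ x : ℝ, 1 ≤ x → (#(G.interedges c c') : ℝ) ≤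
        x * ((m : ℝ) + 1) ^ 2 + d * ((#c : ℝ) * #c') := fun x hx => by nlinarith
    by_cases e1 : c = c'
    · exact h5 _ (by rw [if_pos e1]; split_ifs <;> norm_num)
    by_cases e2 : (c, c') ∈ P.nonUniforms G ε
    · exact h5 _ (by rw [if_pos e2]; split_ifs <;> norm_num)
    by_cases e3 : R c c'
    · exact h5 _ (by rw [if_pos e3]; split_ifs; norm_num)
    rw [if_neg e1, if_neg e2, if_neg e3]
    have hu : G.IsUniform ε c c' := by
      by_contra h
      exact e2 ((P.mk_mem_nonUniforms G).2 ⟨hc, hc', e1, h⟩)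
    have hlow : (G.edgeDensity c c' : ℝ) < d := by
      by_contra! h
      exact e3 ⟨e1, hu, h⟩
    have hcpos : (0 : ℝ) < #c := by exact_mod_cast hm0.trans_le (hsz c hc).1
    have hcpos' : (0 : ℝ) < #c' := by exact_mod_cast hm0.trans_le (hsz c' hc').1
    rw [edgeDensity_def] at hlow
    push_cast at hlow
    rw [div_lt_iff₀ (by positivity)] at hlow
    linarith
  have hsum := sum_le_sum hpair
  rw [sum_add_distrib, ← sum_mul, ← mul_sum, sum_add_distrib, sum_add_distrib] at hsum
  have hdiag : ∑ p ∈ P.parts ×ˢ P.parts, (if p.1 = p.2 then (1 : ℝ) else 0) = t := by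
    rw [sum_product]
    simp [ht]
  have hnu : ∑ p ∈ P.parts ×ˢ P.parts, (if p ∈ P.nonUniforms G ε then (1 : ℝ) else 0)
      ≤ t ^ 2 * ε := by
    rw [← sum_filter, sum_const, nsmul_eq_mul, mul_one]
    have h1 : (#{p ∈ P.parts ×ˢ P.parts | p ∈ P.nonUniforms G ε} : ℝ) ≤ #(P.nonUniforms G ε) := by
      exact_mod_cast card_le_card fun p hp => (mem_filter.1 hp).2
    refine (h1.trans hPu).trans (mul_le_mul_of_nonneg_right ?_ hε.le)
    rw [sq]
    exact_mod_cast Nat.mul_le_mul_left _ (Nat.sub_le _ _)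
  have hsq : ∑ p ∈ P.parts ×ˢ P.parts, ((#p.1 : ℝ) * #p.2) = n ^ 2 := by
    rw [sum_product]
    simp only
    rw [← sum_mul_sum, sq]
    have := P.sum_card_parts
    rw [card_univ, hV] at this
    rw [← this]; push_cast; rfl
  set r : ℝ := ∑ p ∈ P.parts ×ˢ P.parts, (if R p.1 p.2 then (1 : ℝ) else 0) with hr
  have hrt : r ≤ t ^ 2 := by
    calc r ≤ ∑ p ∈ P.parts ×ˢ P.parts, (1 : ℝ) := sum_le_sum fun p _ => by split_ifs <;> simp
      _ = t ^ 2 := by rw [sum_const, card_product]; simp [sq, ht]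
  rw [hdiag, hsq] at hsum
  have hr0 : 0 ≤ r := sum_nonneg fun p _ => by split_ifs <;> norm_num
  have hmR : 48 ≤ η * m := hBη.trans (mul_le_mul_of_nonneg_left (by exact_mod_cast hBm) hη.le)
  have htR : 32 ≤ η * t := hlη.trans (mul_le_mul_of_nonneg_left (by exact_mod_cast hPl) hη.le)
  have hmtR : (m : ℝ) * t ≤ n := by exact_mod_cast hmt
  refine ⟨{c // c ∈ P.parts}, inferInstance, fun c => c.1, fun c c' => R c.1 c'.1, m, hm0, ?_, hnM,
    ?_, ?_, fun c => hsz c.1 c.2, fun a b hab => P.disjoint a.2 b.2 fun h => hab (Subtype.ext h),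
    ?_, ?_, ?_⟩
  · rwa [Fintype.card_coe]
  · simpa using hPM
  · simpa using hmt
  · rintro a b ⟨h1, h2, h3⟩
    exact ⟨h1.symm, h2.symm, by rwa [G.edgeDensity_comm]⟩
  · have hr' : ∑ c : {c // c ∈ P.parts}, (#{c' : {c // c ∈ P.parts} | R c.1 c'.1} : ℝ) = r := by
      rw [hr, sum_product, ← sum_coe_sort P.parts]
      refine sum_congr rfl fun c _ => ?_
      rw [← sum_coe_sort P.parts, sum_boole]
    have h := reduced_density_bound hη hη1 hεη hd hmR htR hnu hrt hr0 hmtR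
      (hdeg.trans (hcount.trans hsum))
    rw [← hr'] at h
    rw [Fintype.card_coe, ← ht]
    convert h
  · rintro c c' ⟨h1, h2, h3⟩ F hF hFc
    exact card_atypical_le G h2 h3 hF hFc

theorem exists_adj_dist_lt {V : Type*} {G : SimpleGraph V} (hG : G.Connected) {u v : V}
    (huv : v ≠ u) : ∃ w, G.Adj v w ∧ G.dist u w < G.dist u v := by
  obtain ⟨p, hp⟩ := hG.exists_walk_length_eq_dist v u
  cases p with
  | nil => exact absurd rfl huv
  | cons h q =>
    refine ⟨_, h, ?_⟩
    have := dist_le q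
    rw [Walk.length_cons] at hp
    rw [dist_comm, G.dist_comm (u := u)]
    omega

/-- The vertices of a tree can be enumerated such that every vertex but the first one has exactly
one neighbour preceding it. The first vertex may be chosen in the smaller colour class `A`. -/
theorem exists_tree_order {k : ℕ} (hk : 2 ≤ k) {T : SimpleGraph (Fin k)} (hT : T.IsTree) :
    ∃ (par : ℕ → ℕ) (A : ℕ → Prop), A 0 ∧ (∀ x < k, 0 < x → par x < x) ∧
      (∀ x < k, 0 < x → (A x ↔ ¬ A (par x))) ∧
      (∀ x < k, ∃ v, #{y ∈ range k | 0 < y ∧ par y = x} ≤ degree' T v) ∧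
      2 * #(subRange k A) ≤ k ∧
      ∀ {V : Type} (G : SimpleGraph V) (φ : ℕ → V), Set.InjOn φ {x | x < k} →
        (∀ x < k, 0 < x → G.Adj (φ (par x)) (φ x)) → Contains G T := by
  classical
  -- the smaller colour class
  have hcol : ∃ S : Finset (Fin k), (∀ x y, T.Adj x y → (x ∈ S ↔ ¬ y ∈ S)) ∧ 2 * #S ≤ k ∧
      ∃ r, r ∈ S := by
    have hr0 : 0 < k := by omega
    set r₀ : Fin k := ⟨0, hr0⟩
    set B : Fin k → Prop := fun x => Even (T.dist r₀ x) with hB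
    have hadj : ∀ x y, T.Adj x y → (B x ↔ ¬ B y) := by
      intro x y h
      rcases hT.dist_eq_dist_add_one_of_adj r₀ h with h | h <;> simp only [hB, h, Nat.even_add_one]
      rw [not_not]
    have hBr : B r₀ := by simp [hB]
    have hcard : #(univ.filter B) + #(univ.filter fun x => ¬ B x) = k := by
      simpa using card_filter_add_card_filter_not (s := univ) B
    rcases le_total #(univ.filter B) #(univ.filter fun x => ¬ B x) with h | h
    · exact ⟨univ.filter B, by simpa using hadj, by omega, r₀, by simpa using hBr⟩
    · have hne : (⟨1, by omega⟩ : Fin k) ≠ r₀ := fun h => by simp [r₀] at h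
      obtain ⟨w, hw, -⟩ := exists_adj_dist_lt hT.connected hne.symm
      exact ⟨univ.filter fun x => ¬ B x, fun x y hxy => by simpa using not_congr (hadj x y hxy), by omega, w,
        by simpa using (hadj _ _ hw).1 hBr⟩
  obtain ⟨S, hBadj, hBk, r, hBr⟩ := hcol
  set f : Fin k → ℕ := T.dist r with hf
  set σ := Tuple.sort f with hσ
  have hmono : ∀ i j : Fin k, i ≤ j → f (σ i) ≤ f (σ j) := fun i j h => Tuple.monotone_sort f h
  have hlt : ∀ i j : Fin k, f (σ i) < f (σ j) → i < j := fun i j h => by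
    by_contra! h'
    exact absurd (hmono _ _ h') (by omega)
  have h0 : σ ⟨0, by omega⟩ = r := by
    have h1 := hmono ⟨0, by omega⟩ (σ.symm r) (Fin.mk_le_of_le_val (Nat.zero_le _))
    rw [Equiv.apply_symm_apply] at h1
    have h2 : f r = 0 := dist_self
    rw [h2] at h1
    exact ((hT.connected.dist_eq_zero_iff).1 (Nat.le_zero.1 h1)).symm
  have hpar : ∀ x : Fin k, 0 < x.1 → ∃ y : Fin k, y < x ∧ T.Adj (σ y) (σ x) := by
    intro x hx
    have hne : σ x ≠ r := by
      rw [← h0]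
      intro h
      have := σ.injective h
      rw [this] at hx
      simp at hx
    obtain ⟨w, hw, hwd⟩ := exists_adj_dist_lt hT.connected hne
    refine ⟨σ.symm w, hlt _ _ ?_, ?_⟩
    · rwa [Equiv.apply_symm_apply]
    · rw [Equiv.apply_symm_apply]; exact hw.symm
  choose! p hp1 hp2 using hpar
  set par : ℕ → ℕ := fun x => if h : x < k then (p ⟨x, h⟩).1 else 0 with hpardef
  have hparx : ∀ x : Fin k, par x.1 = (p x).1 := fun x => by
    simp [hpardef, x.2]
  -- every edge joins a vertex to its parent
  have hedge : ∀ i j : Fin k, T.Adj (σ i) (σ j) → (0 < j.1 ∧ p j = i) ∨ (0 < i.1 ∧ p i = j) := by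
    set E : Finset (Sym2 (Fin k)) :=
      (univ.filter fun x : Fin k => 0 < x.1).image fun x => s(σ (p x), σ x) with hE
    have hsub : E ⊆ T.edgeFinset := by
      intro e he
      obtain ⟨x, hx, rfl⟩ := mem_image.1 he
      rw [mem_edgeFinset]
      exact hp2 x (mem_filter.1 hx).2
    have hEcard : #E = k - 1 := by
      rw [hE, card_image_of_injOn]
      · have : (univ.filter fun x : Fin k => 0 < x.1) = univ.erase ⟨0, by omega⟩ := by
          ext x
          simp [Fin.ext_iff, Nat.pos_iff_ne_zero]
        rw [this, card_erase_of_mem (mem_univ _), card_univ, Fintype.card_fin]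
      · intro x hx y hy hxy
        have hx' := hp1 x (mem_filter.1 hx).2
        have hy' := hp1 y (mem_filter.1 hy).2
        rcases Sym2.eq_iff.1 hxy with ⟨-, h⟩ | ⟨h1, h2⟩
        · exact σ.injective h
        · have h3 := σ.injective h1
          have h4 := σ.injective h2
          rw [h3] at hx'
          rw [← h4] at hy'
          exact absurd hx' (not_lt.2 hy'.le)
    have heq : E = T.edgeFinset := by
      refine eq_of_subset_of_card_le hsub ?_
      have := hT.card_edgeFinset
      rw [Fintype.card_fin] at this
      omega
    intro i j hij
    have : s(σ i, σ j) ∈ E := by rw [heq, mem_edgeFinset]; exact hij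
    obtain ⟨x, hx, hxe⟩ := mem_image.1 this
    have hx0 := (mem_filter.1 hx).2
    rcases Sym2.eq_iff.1 hxe with ⟨h1, h2⟩ | ⟨h1, h2⟩
    · left
      rw [← σ.injective h2]
      exact ⟨hx0, σ.injective h1⟩
    · right
      rw [← σ.injective h2]
      exact ⟨hx0, σ.injective h1⟩
  set A : ℕ → Prop := fun x => ∃ h : x < k, σ ⟨x, h⟩ ∈ S with hA
  have hAx : ∀ x : Fin k, A x.1 ↔ σ x ∈ S := fun x => ⟨fun ⟨_, h⟩ => h, fun h => ⟨x.2, h⟩⟩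
  refine ⟨par, A, ⟨by omega, by rwa [h0]⟩, ?_, ?_, ?_, ?_, ?_⟩
  · intro x hx h
    have := hp1 ⟨x, hx⟩ h
    rw [hparx ⟨x, hx⟩]
    exact this
  · intro x hx h
    rw [hparx ⟨x, hx⟩, hAx, hAx ⟨x, hx⟩]
    exact hBadj _ _ (hp2 ⟨x, hx⟩ h).symm
  · intro x hx
    refine ⟨σ ⟨x, hx⟩, ?_⟩
    rw [degree', Set.ncard_eq_toFinset_card']
    refine card_le_card_of_injOn (fun y => if h : y < k then σ ⟨y, h⟩ else r) ?_ ?_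
    · intro y hy
      obtain ⟨hyk, hy0, hyx⟩ := mem_filter.1 hy
      rw [mem_range] at hyk
      rw [hparx ⟨y, hyk⟩] at hyx
      have h1 := hp2 ⟨y, hyk⟩ hy0
      rw [show p ⟨y, hyk⟩ = ⟨x, hx⟩ from Fin.ext hyx] at h1
      simp only [dif_pos hyk]
      simpa using h1
    · intro y hy z hz hyz
      have hyk := mem_range.1 (mem_filter.1 hy).1
      have hzk := mem_range.1 (mem_filter.1 hz).1
      simp only [dif_pos hyk, dif_pos hzk] at hyz
      simpa using σ.injective hyz
  · refine le_trans (Nat.mul_le_mul_left 2 ?_) hBk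
    refine card_le_card_of_injOn (fun y => if h : y < k then σ ⟨y, h⟩ else r) ?_ ?_
    · intro y hy
      obtain ⟨hyk, _, hy⟩ := mem_subRange.1 hy
      simp only [dif_pos hyk]
      simpa using hy
    · intro y hy z hz hyz
      have hyk := (mem_subRange.1 hy).1
      have hzk := (mem_subRange.1 hz).1
      simp only [dif_pos hyk, dif_pos hzk] at hyz
      simpa using σ.injective hyz
  · intro V G φ hinj hadj
    refine ⟨fun x => φ (σ.symm x).1, fun x y hxy => ?_, fun x y hxy => ?_⟩
    · exact σ.symm.injective (Fin.ext (hinj (σ.symm x).2 (σ.symm y).2 hxy))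
    · have h1 := hedge (σ.symm x) (σ.symm y) (by simpa using hxy)
      rcases h1 with ⟨h2, h3⟩ | ⟨h2, h3⟩
      · have := hadj _ (σ.symm y).2 h2
        rwa [hparx, h3] at this
      · have := hadj _ (σ.symm x).2 h2
        rw [hparx, h3] at this
        exact this.symm

open Classical in
/-- A relation of average degree `D` has a restriction of minimum degree at least `D / 2` and
maximum degree at least `D`. -/
theorem exists_subset_min_degree {ι : Type*} [Fintype ι] {R : ι → ι → Prop}
    (hR : ∀ a b, R a b → R b a) {D : ℝ} (hD : 0 < D) (hι : 0 < Fintype.card ι)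
    (h : D * Fintype.card ι ≤ ∑ c, (#{c' | R c c'} : ℝ)) :
    ∃ U : Finset ι, (∃ v ∈ U, D ≤ #{c ∈ U | R v c}) ∧
      ∀ c ∈ U, D / 2 ≤ #{c' ∈ U | R c c'} := by
  set 𝒰 : Finset (Finset ι) :=
    univ.filter fun U => U.Nonempty ∧ D * #U ≤ ∑ c ∈ U, (#{c' ∈ U | R c c'} : ℝ) with h𝒰
  have hne : 𝒰.Nonempty := by
    refine ⟨univ, mem_filter.2 ⟨mem_univ _, ?_, by rw [card_univ]; exact h⟩⟩
    rw [← card_pos, card_univ]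
    exact hι
  obtain ⟨U, hU, hmin⟩ := exists_min_image 𝒰 card hne
  obtain ⟨-, hUne, hUD⟩ := mem_filter.1 hU
  refine ⟨U, ?_, ?_⟩
  · obtain ⟨v, hv, hvD⟩ := exists_le_of_sum_le (s := U) (f := fun _ => D)
      (g := fun c => (#{c' ∈ U | R c c'} : ℝ)) hUne
      (by rwa [sum_const, nsmul_eq_mul, mul_comm])
    exact ⟨v, hv, hvD⟩
  · intro c hc
    by_contra! hlt
    have hsplit : ∀ a ∈ U.erase c, (#{b ∈ U | R a b} : ℝ) ≤
        #{b ∈ U.erase c | R a b} + if R c a then (1 : ℝ) else 0 := by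
      intro a ha
      rw [← insert_erase hc, filter_insert, insert_erase hc]
      by_cases hac : R a c
      · rw [if_pos hac, if_pos (hR _ _ hac)]
        exact_mod_cast card_insert_le _ _
      · rw [if_neg hac]
        have : (0 : ℝ) ≤ if R c a then (1 : ℝ) else 0 := by split_ifs <;> norm_num
        linarith
    have hsum := sum_le_sum hsplit
    rw [sum_add_distrib, sum_boole] at hsum
    have hle : (#{a ∈ U.erase c | R c a} : ℝ) ≤ #{a ∈ U | R c a} := by
      exact_mod_cast card_le_card (filter_subset_filter _ (erase_subset _ _))
    have hcU := add_sum_erase U (fun c => (#{c' ∈ U | R c c'} : ℝ)) hc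
    have hcard : (#(U.erase c) : ℝ) = #U - 1 := by
      rw [card_erase_of_mem hc, Nat.cast_sub (card_pos.2 hUne), Nat.cast_one]
    by_cases hUc : (U.erase c).Nonempty
    · have hmem : U.erase c ∈ 𝒰 := by
        refine mem_filter.2 ⟨mem_univ _, hUc, ?_⟩
        rw [hcard]
        linarith
      exact absurd (hmin _ hmem) (not_le.2 (card_erase_lt_of_mem hc))
    · rw [not_nonempty_iff_eq_empty] at hUc
      rw [hUc, sum_empty] at hcU
      rw [hUc, card_empty, Nat.cast_zero] at hcard
      rw [show (#U : ℝ) = 1 by linarith] at hUD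
      linarith

open Classical in
/-- A tree on `k` vertices embeds greedily into a graph of minimum degree at least `k`. -/
theorem exists_greedy_embedding {V : Type*} {G : SimpleGraph V} {U : Finset V} {k : ℕ}
    {par : ℕ → ℕ} (hU : U.Nonempty) (hdeg : ∀ u ∈ U, k ≤ #{x ∈ U | G.Adj u x})
    (hpar : ∀ x < k, 0 < x → par x < x) :
    ∃ φ : ℕ → V, Set.InjOn φ {x | x < k} ∧ ∀ x < k, 0 < x → G.Adj (φ (par x)) (φ x) := by
  have key : ∀ j ≤ k, ∃ φ : ℕ → V, (∀ x < j, φ x ∈ U) ∧ Set.InjOn φ {x | x < j} ∧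
      ∀ x < j, 0 < x → G.Adj (φ (par x)) (φ x) := by
    intro j
    induction j with
    | zero =>
      obtain ⟨u, -⟩ := hU
      exact fun _ => ⟨fun _ => u, by simp⟩
    | succ j ih =>
      intro hj
      obtain ⟨φ, h1, h2, h3⟩ := ih (by omega)
      have hex : ∃ w ∈ U, w ∉ (range j).image φ ∧ (0 < j → G.Adj (φ (par j)) w) := by
        rcases Nat.eq_zero_or_pos j with rfl | hj0
        · obtain ⟨u, hu⟩ := hU
          exact ⟨u, hu, by simp⟩
        · have hlt : #((range j).image φ) < #{x ∈ U | G.Adj (φ (par j)) x} :=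
            lt_of_le_of_lt card_image_le (by
              rw [card_range]
              exact lt_of_lt_of_le (by omega) (hdeg _ (h1 _ (hpar j (by omega) hj0))))
          obtain ⟨w, hw, hw'⟩ := exists_mem_notMem_of_card_lt_card hlt
          exact ⟨w, (mem_filter.1 hw).1, hw', fun _ => (mem_filter.1 hw).2⟩
      obtain ⟨w, hwU, hwφ, hwadj⟩ := hex
      have hlt : ∀ x < j, Function.update φ j w x = φ x := fun x hx =>
        Function.update_of_ne (by omega) _ _
      have hw : ∀ x < j, φ x ≠ w := fun x hx h => hwφ (mem_image.2 ⟨x, mem_range.2 hx, h⟩)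
      refine ⟨Function.update φ j w, ?_, ?_, ?_⟩
      · intro x hx
        rcases Nat.lt_succ_iff_lt_or_eq.1 hx with hx | rfl
        · rw [hlt x hx]; exact h1 x hx
        · rwa [Function.update_self]
      · intro x hx y hy hxy
        rcases Nat.lt_succ_iff_lt_or_eq.1 hx with hx | rfl <;>
          rcases Nat.lt_succ_iff_lt_or_eq.1 hy with hy | rfl
        · rw [hlt x hx, hlt y hy] at hxy
          exact h2 hx hy hxy
        · rw [hlt x hx, Function.update_self] at hxy
          exact absurd hxy (hw x hx)
        · rw [hlt y hy, Function.update_self] at hxy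
          exact absurd hxy.symm (hw y hy)
        · rfl
      · intro x hx hx0
        rcases Nat.lt_succ_iff_lt_or_eq.1 hx with hx | rfl
        · rw [hlt x hx, hlt _ (lt_trans (hpar x (by omega) hx0) hx)]
          exact h3 x hx hx0
        · rw [Function.update_self, hlt _ (hpar x (by omega) hx0)]
          exact hwadj hx0
  obtain ⟨φ, -, h⟩ := key k le_rfl
  exact ⟨φ, h⟩

open Classical in
/-- Double counting: if every `a ∈ N` is bad for few `s ∈ S`, few `s ∈ S` have many bad `a`. -/
theorem card_many_bad_mul_le {α β : Type*} {S : Finset α} {N : Finset β} {P : α → β → Prop}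
    {e u : ℝ} (h : ∀ a ∈ N, (#{s ∈ S | P s a} : ℝ) ≤ e) :
    (#{s ∈ S | u < #{a ∈ N | P s a}} : ℝ) * u ≤ #N * e := by
  set X := {s ∈ S | u < (#{a ∈ N | P s a} : ℝ)} with hX
  calc (#X : ℝ) * u = ∑ s ∈ X, u := by rw [sum_const, nsmul_eq_mul]
    _ ≤ ∑ s ∈ X, (#{a ∈ N | P s a} : ℝ) := sum_le_sum fun s hs => (mem_filter.1 hs).2.le
    _ ≤ ∑ s ∈ S, (#{a ∈ N | P s a} : ℝ) :=
      sum_le_sum_of_subset_of_nonneg (filter_subset _ _) fun _ _ _ => Nat.cast_nonneg _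
    _ = ∑ a ∈ N, (#{s ∈ S | P s a} : ℝ) := by
      exact_mod_cast sum_card_bipartiteAbove_eq_sum_card_bipartiteBelow P
    _ ≤ ∑ a ∈ N, e := sum_le_sum h
    _ = #N * e := by rw [sum_const, nsmul_eq_mul]

open Classical in
/-- A tree, cut into small pieces, embeds into a graph with clusters `C` whose reduced graph `R`
has large average degree. -/
theorem exists_embedding_of_clusters {ι V : Type*} [Fintype ι] (G : SimpleGraph V)
    (C : ι → Finset V) (R : ι → ι → Prop) {m z : ℕ} {f g e₁ δ κ e d u : ℝ}
    (hC : ∀ c, m ≤ #(C c)) (hCC : ∀ a b, a ≠ b → Disjoint (C a) (C b))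
    (hRs : ∀ a b, R a b → R b a)
    (hR : ∀ c c', R c c' → ∀ F ⊆ C c', f ≤ #F →
      (#{x ∈ C c | (#{z ∈ F | G.Adj x z} : ℝ) < g} : ℝ) ≤ e₁)
    (hι : 0 < Fintype.card ι) (hd : 0 < d)
    (hdR : d * Fintype.card ι ≤ ∑ c, (#{c' | R c c'} : ℝ))
    (hδ0 : 0 ≤ δ) (hδ : δ ≤ 1 / 2) (hκ : 0 < κ)
    (par : ℕ → ℕ) (A : ℕ → Prop) (D : Finset ℕ) (k L : ℕ) (hk : 0 < k)
    (hpar : ∀ x < k, 0 < x → par x < x)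
    (hA : ∀ x < k, 0 < x → (A x ↔ ¬ A (par x))) (hA0 : A 0)
    (hAk : 2 * #(subRange k A) ≤ k) (h0D : 0 ∈ D)
    (hL : ∀ d < k, #{x ∈ range k | pieceRoot par (D : Set ℕ) x = d} ≤ L)
    (hDpar : ∀ d ∈ D, 0 < d → ¬ A d → par d ∈ D)
    (hkd : k ≤ κ * d) (hzm : z ≤ m) (hf0 : 0 ≤ f) (hfz : 2 * f ≤ z) (hu : 0 < u)
    (hue : Fintype.card ι * e₁ ≤ u * f) (huκ : 2 * (κ * u) ≤ δ * k)
    (he0 : 0 ≤ e) (he : 5 * (L : ℝ) * k ≤ e ^ 2)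
    (hcap : κ / (1 - δ) + e + f + z ≤ m) (hgf : g ≤ f)
    (hnumD : 2 * e₁ + #D < g) (hnumL : 2 * e₁ + L < g) :
    ∃ φ : ℕ → V, Set.InjOn φ {x | x < k} ∧
      ∀ x < k, 0 < x → G.Adj (φ (par x)) (φ x) := by
  choose Z hZC hZz using fun c => exists_subset_card_eq (hzm.trans (hC c))
  obtain ⟨U, ⟨v, hvU, hv⟩, hU⟩ := exists_subset_min_degree hRs hd hι hdR
  set P := (#(subRange k fun x => ¬ A x) : ℝ) with hP
  set Q := (#(subRange k A) : ℝ) with hQ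
  have hk0 : (0 : ℝ) < k := by exact_mod_cast hk
  have hPQ : P + Q = k := by
    have := card_subRange_add (k := k) (P := fun _ => True) (Q := fun x => ¬ A x) (T := A)
      (fun x _ => ⟨fun _ => (Classical.em (A x)).symm, fun _ => trivial⟩) fun x _ h => h
    rw [← this]
    simp [subRange]
  have hAk' : 2 * Q ≤ k := by rw [hQ]; exact_mod_cast hAk
  have hP2 : (k : ℝ) ≤ 2 * P := by linarith
  obtain ⟨y, hy0, hyN, hy1, hyκ⟩ := exists_skew_matching (P := P) (Q := Q) (κ := κ)
    {c ∈ U | R v c} (fun a => {c ∈ U | R a c}) (Nat.cast_nonneg _) (by linarith) (by linarith)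
    (by
      rw [hPQ]
      exact hkd.trans (mul_le_mul_of_nonneg_left hv hκ.le))
    (by
      intro a ha
      have := mul_le_mul_of_nonneg_left (hU a (mem_filter.1 ha).1) hκ.le
      rw [hPQ]
      linarith) hκ
  have hyR : ∀ a b, 0 < y a b → R v a ∧ R a b := fun a b h =>
    ⟨(mem_filter.1 (hyN a b h).1).2, (mem_filter.1 (hyN a b h).2).2⟩
  have hZf : ∀ c, f ≤ #(Z c) := fun c => by rw [hZz]; linarith
  set E : V → Finset ι := fun s => {a ∈ {c ∈ U | R v c} | (#{z ∈ Z a | G.Adj s z} : ℝ) < g} with hE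
  have hEmass : ∀ s, (#(E s) : ℝ) ≤ u → ∑ a ∈ E s, ∑ b, y a b ≤ δ := by
    intro s hs
    have h1 : ∀ a, (k : ℝ) * ∑ b, y a b ≤ 2 * κ := by
      intro a
      have h2 : 0 ≤ ∑ b, y a b := sum_nonneg fun b _ => hy0 a b
      have h3 : 0 ≤ Q * ∑ b, y b a :=
        mul_nonneg (Nat.cast_nonneg _) (sum_nonneg fun b _ => hy0 b a)
      have h4 := hyκ a
      have h5 := mul_le_mul_of_nonneg_right hP2 h2
      linarith
    have h2 : (k : ℝ) * ∑ a ∈ E s, ∑ b, y a b ≤ k * δ := by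
      rw [mul_sum]
      calc ∑ a ∈ E s, (k : ℝ) * ∑ b, y a b ≤ ∑ a ∈ E s, 2 * κ := sum_le_sum fun a _ => h1 a
        _ = #(E s) * (2 * κ) := by rw [sum_const, nsmul_eq_mul]
        _ ≤ u * (2 * κ) := mul_le_mul_of_nonneg_right hs (by linarith)
        _ ≤ k * δ := by linarith
    exact le_of_mul_le_mul_left h2 hk0
  set X : Finset V := {s ∈ Z v | u < (#(E s) : ℝ)} with hX
  have hXf : (#X : ℝ) ≤ f := by
    have he₁ : 0 ≤ e₁ := by
      by_contra! hneg
      have h1 : 0 ≤ u * f := mul_nonneg hu.le hf0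
      have hvN : {c ∈ U | R v c}.Nonempty := by
        rw [← card_pos]
        have : (0 : ℝ) < #{c ∈ U | R v c} := hd.trans_le hv
        exact_mod_cast this
      obtain ⟨c, hc⟩ := hvN
      have := hR v c (mem_filter.1 hc).2 (Z c) (hZC c) (hZf c)
      exact absurd (this.trans_lt hneg) (not_lt.2 (Nat.cast_nonneg _))
    have h1 := card_many_bad_mul_le (S := Z v) (N := {c ∈ U | R v c})
      (P := fun s a => (#{z ∈ Z a | G.Adj s z} : ℝ) < g) (e := e₁) (u := u) (by
        intro a ha
        refine le_trans ?_ (hR v a (mem_filter.1 ha).2 (Z a) (hZC a) (hZf a))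
        exact_mod_cast card_le_card (filter_subset_filter _ (hZC v)))
    have h2 : (#{c ∈ U | R v c} : ℝ) * e₁ ≤ Fintype.card ι * e₁ := by
      refine mul_le_mul_of_nonneg_right ?_ he₁
      exact_mod_cast card_le_univ _
    have h3 : (#X : ℝ) * u ≤ f * u := by linarith
    exact le_of_mul_le_mul_right h3 hu
  have hWZu : ∀ c, C c \ Z c ∪ Z c = C c := fun c => sdiff_union_of_subset (hZC c)
  refine exists_tree_embedding G (fun c => C c \ Z c) Z v (Z v \ X) R y (f := f) (g := g)
    (e₁ := e₁) (δ := δ) (κ := κ) (e := e) ?_ ?_ ?_ sdiff_subset ?_ ?_ hy0 hy1 ?_ hδ0 hδ par A D k L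
    hpar hA hA0 h0D hL hDpar hyκ he0 he ?_ hgf hnumD hnumL
  · exact fun a b hab => (hCC a b hab).mono sdiff_subset sdiff_subset
  · intro a b
    by_cases hab : a = b
    · rw [hab]; exact sdiff_disjoint
    · exact (hCC a b hab).mono sdiff_subset (hZC b)
  · intro c c' hcc F hF hFf
    rw [hWZu] at hF ⊢
    exact hR c c' hcc F hF hFf
  · rw [card_sdiff_of_subset (filter_subset _ _), Nat.cast_sub (card_le_card (filter_subset _ _)),
      hZz]
    linarith
  · intro s hs
    obtain ⟨hsZ, hsX⟩ := mem_sdiff.1 hs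
    refine ⟨E s, hEmass s ?_, fun a ha b hab => ?_⟩
    · by_contra! h
      exact hsX (mem_filter.2 ⟨hsZ, h⟩)
    · by_contra! h
      exact ha (mem_filter.2 ⟨(hyN a b hab).1, h⟩)
  · intro a b hab
    obtain ⟨h1, h2⟩ := hyR a b hab
    exact ⟨h2, hRs _ _ h2, hRs _ _ h1, h1⟩
  · intro c
    rw [card_sdiff_of_subset (hZC c), Nat.cast_sub (card_le_card (hZC c)), hZz]
    have : (m : ℝ) ≤ #(C c) := by exact_mod_cast hC c
    linarith

open Classical in
theorem degree'_eq_degree {V : Type*} [Fintype V] (G : SimpleGraph V) (v : V) :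
    degree' G v = G.degree v := by
  rw [degree', Set.ncard_eq_toFinset_card', ← card_neighborFinset_eq_degree]
  congr

/-- Capacity bound for the weights `κ = (1 - η / 4) m` and `δ = η / 8`. -/
theorem capacity_le {η m z : ℝ} (hη : 0 < η) (hη1 : η ≤ 1) (hm : 0 ≤ m) (hz : z ≤ η * m / 16) :
    (1 - η / 4) * m / (1 - η / 8) + η * m / 64 + η * m / 64 + z ≤ m := by
  have h1 : (1 - η / 4) * m / (1 - η / 8) ≤ (1 - η / 8) * m := by
    rw [div_le_iff₀ (by linarith)]
    nlinarith [mul_nonneg (sq_nonneg η) hm]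
  linarith [mul_nonneg hη.le hm]

theorem le_matching_capacity {η m n k : ℝ} (hη : 0 < η) (hη1 : η ≤ 1) (hm : 0 < m) (hn : 0 ≤ n)
    (hkn : k ≤ n) : k ≤ (1 - η / 4) * m * ((k + η / 2 * n) / m) := by
  have h1 : (1 - η / 4) * m * ((k + η / 2 * n) / m) = (1 - η / 4) * (k + η / 2 * n) := by
    field_simp
  rw [h1]
  have h2 : η * k ≤ η * n := mul_le_mul_of_nonneg_left hkn hη.le
  have h3 : η * (η * n) ≤ 1 * (η * n) := mul_le_mul_of_nonneg_right hη1 (mul_nonneg hη.le hn)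
  linarith [mul_nonneg hη.le hn]

open Classical in
/-- Every tree of small maximum degree, given by its parent map `par`, embeds into a large graph of
average degree at least `k + η n`, provided that `k > η n`. -/
theorem exists_embedding_of_dense {η : ℝ} (hη : 0 < η) (hη1 : η ≤ 1) :
    ∃ (n₀ : ℕ) (γ : ℝ), 0 < γ ∧ ∀ (V : Type) [Fintype V] (G : SimpleGraph V) (n k : ℕ),
      Fintype.card V = n → n₀ < n → η * n < k → k ≤ n →
      (k + η * n) * n ≤ ∑ v, (G.degree v : ℝ) →
      ∀ (par : ℕ → ℕ) (A : ℕ → Prop), A 0 → (∀ x < k, 0 < x → par x < x) →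
        (∀ x < k, 0 < x → (A x ↔ ¬ A (par x))) →
        (∀ x < k, (#{y ∈ range k | 0 < y ∧ par y = x} : ℝ) ≤ γ * k) →
        2 * #(subRange k A) ≤ k →
        ∃ φ : ℕ → V, Set.InjOn φ {x | x < k} ∧
          ∀ x < k, 0 < x → G.Adj (φ (par x)) (φ x) := by
  have hη2 : 0 < η ^ 2 := by positivity
  have hη3 : 0 < η ^ 3 := by positivity
  have hη21 : η ^ 2 ≤ 1 := pow_le_one₀ hη.le hη1
  have hη32 : η ^ 3 ≤ η ^ 2 := pow_le_pow_of_le_one hη.le hη1 (by norm_num)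
  have hη2η : η ^ 2 ≤ η := by nlinarith
  set ε : ℝ := η ^ 3 / 16384 with hε
  obtain ⟨M, n₁, hM, hreg⟩ := exists_reduced_graph (η := η) (ε := ε) (d := η / 8) hη hη1
    (by positivity) (by linarith) (by linarith) le_rfl
  have hM1 : (1 : ℝ) ≤ M := by exact_mod_cast hM
  have hM0 : (0 : ℝ) < M := by linarith
  set c : ℝ := η ^ 2 / (81920 * M) with hc
  have hc0 : 0 < c := by positivity
  have hcM : c * M = η ^ 2 / 81920 := by rw [hc]; field_simp
  set γ : ℝ := c * η ^ 2 / (32768 * M ^ 2) with hγ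
  have hγ0 : 0 < γ := by positivity
  have hγM : γ * M ^ 2 = c * η ^ 2 / 32768 := by rw [hγ]; field_simp
  set X : ℝ := 32 / η + 1 / c + (1 + 4 * M / c) * 8192 / η ^ 2 with hX
  refine ⟨max n₁ ⌈2 * M * X⌉₊, γ, hγ0, ?_⟩
  intro V _ G n k hV hn hkη hkn hdeg par A hA0 hpar hA hch hAk
  have hn1 : n₁ ≤ n := (lt_of_le_of_lt (le_max_left _ _) hn).le
  have hnX : 2 * M * X ≤ n :=
    (Nat.le_ceil _).trans (by exact_mod_cast (lt_of_le_of_lt (le_max_right _ _) hn).le)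
  have hn0 : (0 : ℝ) ≤ n := Nat.cast_nonneg n
  have hkn' : (k : ℝ) ≤ n := by exact_mod_cast hkn
  have hk0 : (0 : ℝ) < k := lt_of_le_of_lt (mul_nonneg hη.le hn0) hkη
  have hk : 0 < k := by exact_mod_cast hk0
  obtain ⟨ι, _, C, R, m, hm, hι, hnM, hιM, hmt, hC, hCC, hRs, hdR, hR⟩ :=
    hreg V G n k hV hn1 hdeg
  have hm0 : (0 : ℝ) < m := by exact_mod_cast hm
  have hm1 : (1 : ℝ) ≤ m := by exact_mod_cast hm
  have hι0 : (0 : ℝ) < Fintype.card ι := by exact_mod_cast hι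
  have hnM' : (n : ℝ) ≤ 2 * M * m := by exact_mod_cast hnM
  have hmt' : (m : ℝ) * Fintype.card ι ≤ n := by exact_mod_cast hmt
  -- `m` is large
  have hXm : X ≤ m := le_of_mul_le_mul_left (hnX.trans hnM') (by positivity)
  have ha1 : 0 < 32 / η := by positivity
  have ha2 : 0 < 1 / c := by positivity
  have ha3 : 0 < (1 + 4 * M / c) * 8192 / η ^ 2 := by positivity
  have hb1 : 32 ≤ m * η := (div_le_iff₀ hη).1 (by linarith)
  have hb2 : 1 ≤ m * c := (div_le_iff₀ hc0).1 (by linarith)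
  have hb3 : (1 + 4 * M / c) * 8192 ≤ m * η ^ 2 := (div_le_iff₀ hη2).1 (by linarith)
  -- the bound on the size of the pieces
  set L : ℕ := ⌊2 * c * m⌋₊ with hLdef
  have hL2 : (L : ℝ) ≤ 2 * c * m := Nat.floor_le (by positivity)
  have hL1 : c * m ≤ L := by
    have := Nat.lt_floor_add_one (2 * c * m)
    linarith
  have hL0 : (0 : ℝ) < L := by linarith
  obtain ⟨D, h0D, hDL, -, hDk, hDpar⟩ := exists_piece_roots par A k L ⌊γ * k⌋₊
    (by exact_mod_cast hL0) hk hpar hA fun x hx => Nat.le_floor (hch x hx)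
  have hDcard : (#D : ℝ) ≤ η ^ 2 * m / 4096 := by
    have h1 : ((#D : ℝ) - 1) * L ≤ k * (γ * k + 2) := by
      have h2 : 1 ≤ #D := card_pos.2 ⟨0, h0D⟩
      have h3 : (((#D - 1) * L : ℕ) : ℝ) ≤ (k * (⌊γ * k⌋₊ + 2) : ℕ) := by exact_mod_cast hDL
      push_cast [Nat.cast_sub h2] at h3
      refine h3.trans (mul_le_mul_of_nonneg_left ?_ hk0.le)
      linarith [Nat.floor_le (mul_pos hγ0 hk0).le]
    have hk2 : (k : ℝ) ≤ 2 * M * m := hkn'.trans hnM'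
    have h2 : (k : ℝ) * (γ * k + 2) ≤ 2 * M * m * (γ * (2 * M * m) + 2) :=
      mul_le_mul hk2 (by linarith [mul_le_mul_of_nonneg_left hk2 hγ0.le]) (by positivity)
        (by positivity)
    have h3 : 2 * M * m * (γ * (2 * M * m) + 2) = (η ^ 2 * m / 8192 + 4 * M / c) * (c * m) := by
      have : 2 * M * m * (γ * (2 * M * m) + 2) = 4 * (γ * M ^ 2) * m ^ 2 + 4 * M * m := by ring
      rw [this, hγM]
      field_simp
      ring
    have h4 : (η ^ 2 * m / 8192 + 4 * M / c) * (c * m) ≤ (η ^ 2 * m / 8192 + 4 * M / c) * L :=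
      mul_le_mul_of_nonneg_left hL1 (by positivity)
    have h5 : (#D : ℝ) - 1 ≤ η ^ 2 * m / 8192 + 4 * M / c :=
      le_of_mul_le_mul_right (by linarith) hL0
    linarith
  -- the parameters of the embedding
  set z : ℕ := ⌈η * m / 32⌉₊ with hz
  have hz1 : η * m / 32 ≤ z := Nat.le_ceil _
  have hz2 : (z : ℝ) ≤ η * m / 16 := by
    have := Nat.ceil_lt_add_one (a := η * m / 32) (by positivity)
    linarith
  have hεm : ((m : ℝ) + 1) * ε ≤ 2 * m * ε :=
    mul_le_mul_of_nonneg_right (by linarith) (by positivity)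
  have hCε : ∀ c, (#(C c) : ℝ) * ε ≤ 2 * m * ε := fun c => by
    refine le_trans (mul_le_mul_of_nonneg_right ?_ (by positivity)) hεm
    exact_mod_cast (hC c).2
  have hηm : η ^ 2 * m ≤ η * m := mul_le_mul_of_nonneg_right hη2η hm0.le
  have hηm' : η * m ≤ 1 * m := mul_le_mul_of_nonneg_right hη1 hm0.le
  have hηm3 : η ^ 3 * m ≤ η ^ 2 * m := mul_le_mul_of_nonneg_right hη32 hm0.le
  have hηm2 : 0 < η ^ 2 * m := by positivity
  refine exists_embedding_of_clusters G C R (m := m) (z := z) (f := η * m / 64)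
    (g := η ^ 2 * m / 1024) (e₁ := 2 * m * ε) (δ := η / 8) (κ := (1 - η / 4) * m)
    (e := η * m / 64) (d := (k + η / 2 * n) / m) (u := η ^ 2 * Fintype.card ι / 16)
    (fun c => (hC c).1) hCC hRs ?_ hι (by positivity) ?_ (by positivity) (by linarith)
    (mul_pos (by linarith) hm0) par A D k L hk hpar hA hA0 hAk h0D hDk hDpar
    (le_matching_capacity hη hη1 hm0 hn0 hkn') ?_ (by positivity) (by linarith) (by positivity)
    ?_ ?_ (by positivity) ?_ (capacity_le hη hη1 hm0.le hz2) (by linarith) ?_ ?_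
  · intro a b hab F hF hFf
    have h1 : 2 * m * ε ≤ η * m / 64 := by
      rw [hε]
      linarith
    refine le_trans ?_ ((hR a b hab F hF ((hCε b).trans (h1.trans hFf))).trans (hCε a))
    have h2 : η ^ 2 * m / 1024 ≤ (η / 8 - ε) * #F := by
      have h3 : η / 16 * (η * m / 64) ≤ (η / 8 - ε) * #F :=
        mul_le_mul (by linarith) hFf (by positivity) (by linarith)
      linarith
    exact_mod_cast card_le_card (monotone_filter_right _ fun x _ hx => lt_of_lt_of_le hx h2)
  · rw [div_mul_eq_mul_div, div_le_iff₀ hm0, mul_comm (∑ c, _)]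
    exact hdR
  · have : (z : ℝ) ≤ m := by linarith
    exact_mod_cast this
  · rw [hε]
    have : 0 < η ^ 3 * m * Fintype.card ι := by positivity
    linarith
  · have h1 : 2 * ((1 - η / 4) * m * (η ^ 2 * Fintype.card ι / 16)) ≤
        η ^ 2 / 8 * (m * Fintype.card ι) := by
      have : 0 ≤ η ^ 3 * (m * Fintype.card ι) := by positivity
      linarith
    have h2 : η ^ 2 / 8 * (m * Fintype.card ι) ≤ η ^ 2 / 8 * n :=
      mul_le_mul_of_nonneg_left hmt' (by positivity)
    have h3 : η / 8 * (η * n) ≤ η / 8 * k := mul_le_mul_of_nonneg_left hkη.le (by positivity)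
    linarith
  · calc 5 * (L : ℝ) * k ≤ 5 * (2 * c * m) * (2 * M * m) :=
        mul_le_mul (by linarith) (hkn'.trans hnM') hk0.le (by positivity)
      _ = 20 * (c * M) * m ^ 2 := by ring
      _ = (η * m / 64) ^ 2 := by rw [hcM]; ring
  · rw [hε]
    linarith
  · have h1 : c * m ≤ c * M * m := by
      rw [mul_assoc]
      exact mul_le_mul_of_nonneg_left (le_mul_of_one_le_left hm0.le hM1) hc0.le
    rw [hcM] at h1
    rw [hε]
    linarith

/-- For every `η > 0` there exist `n₀` and `γ > 0` such that for every `n > n₀` and every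
integer `k > 0`, every graph `G` on `n` vertices with average degree at least `k + ηn`
contains every tree `T` on `k` vertices with maximum degree `Δ(T) ≤ γk`. -/
theorem erdosSos_dense_bounded (η : ℝ) (hη : 0 < η) :
    ∃ (n₀ : ℕ) (γ : ℝ), 0 < γ ∧
      ∀ (n k : ℕ), n₀ < n → 0 < k →
        ∀ G : SimpleGraph (Fin n),
          (k : ℝ) + η * n ≤ avgDeg G →
          ∀ T : SimpleGraph (Fin k), T.IsTree →
            (∀ v, (degree' T v : ℝ) ≤ γ * k) →
            Contains G T := by
  classical
  obtain ⟨n₀, γ, hγ, hdense⟩ :=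
    exists_embedding_of_dense (η := min η 1) (lt_min hη one_pos) (min_le_right _ _)
  refine ⟨n₀, γ, hγ, fun n k hn hk G hG T hT hΔ => ?_⟩
  have hn0 : (0 : ℝ) < n := by exact_mod_cast (Nat.zero_le n₀).trans_lt hn
  have hk0 : (0 : ℝ) < k := by exact_mod_cast hk
  rcases Nat.lt_or_ge k 2 with hk1 | hk2
  · have : Subsingleton (Fin k) := Fin.subsingleton_iff_le_one.2 (by omega)
    exact ⟨fun _ => ⟨0, by omega⟩, Function.injective_of_subsingleton _,
      fun x y h => absurd (Subsingleton.elim x y) h.ne⟩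
  have hdeg : ((k : ℝ) + min η 1 * n) * n ≤ ∑ v, (G.degree v : ℝ) := by
    have h1 : (k : ℝ) + min η 1 * n ≤ avgDeg G := le_trans
      (by linarith [mul_le_mul_of_nonneg_right (min_le_left η 1) hn0.le]) hG
    rw [avgDeg, Fintype.card_fin, le_div_iff₀ hn0] at h1
    simpa only [degree'_eq_degree] using h1
  obtain ⟨par, A, hA0, hpar, hA, hch, hAk, hcont⟩ := exists_tree_order hk2 hT
  suffices h : ∃ φ : ℕ → Fin n, Set.InjOn φ {x | x < k} ∧
      ∀ x < k, 0 < x → G.Adj (φ (par x)) (φ x) by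
    obtain ⟨φ, h1, h2⟩ := h
    exact hcont G φ h1 h2
  have hpos : 0 < min η 1 * n := mul_pos (lt_min hη one_pos) hn0
  rcases le_or_gt (k : ℝ) (min η 1 * n) with hsmall | hlarge
  · obtain ⟨U, ⟨v, hv, -⟩, hU⟩ := exists_subset_min_degree (R := G.Adj)
      (fun _ _ h => h.symm) (D := k + min η 1 * n) (by linarith)
      (by rw [Fintype.card_fin]; exact_mod_cast hn0)
      (by
        rw [Fintype.card_fin]
        convert hdeg using 3 with v
        rw [← card_neighborFinset_eq_degree, neighborFinset_eq_filter])
    refine exists_greedy_embedding ⟨v, hv⟩ (fun u hu => ?_) hpar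
    have : (k : ℝ) ≤ #{x ∈ U | G.Adj u x} := by linarith [hU u hu]
    exact_mod_cast this
  · refine hdense (Fin n) G n k (Fintype.card_fin n) hn hlarge ?_ hdeg par A hA0 hpar hA ?_ hAk
    · have h1 : ∑ v, (G.degree v : ℝ) ≤ ∑ _v : Fin n, (n : ℝ) := sum_le_sum fun v _ => by
        have := G.degree_lt_card_verts v
        rw [Fintype.card_fin] at this
        exact_mod_cast this.le
      rw [sum_const, card_univ, Fintype.card_fin, nsmul_eq_mul] at h1
      have h2 := le_of_mul_le_mul_right (hdeg.trans h1) hn0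
      have h3 : (k : ℝ) ≤ n := by linarith
      exact_mod_cast h3
    · intro x hx
      obtain ⟨v, hv⟩ := hch x hx
      exact le_trans (by exact_mod_cast hv) (hΔ v)
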